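/- arXiv:2006.12116 — 3 statements merged into one kernel-verified Lean document; each statement's English description precedes it below -/
import Mathlib

section
/- Let q be an odd prime power and a₁,a₂,a₃ nonzero polynomials in 𝔽_q[t] such that deg(a_i) ≡ deg(a_j) (mod 2) for some pair i ≠ j but the three degrees do not all have the same parity. Let c_i and c_j be the leading coefficients of a_i and a_j. Then a₁x₁² + a₂x₂² + a₃x₃² = 0 has a nontrivial solution in 𝔽_q((1/t)) if and only if −c_i c_j is a square in 𝔽_q. -/
set_option synthInstance.maxHeartbeats 1000000
set_option maxHeartbeats 1000000

open Polynomial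

theorem PowerSeries.isSquare_of_constantCoeff_eq_sq {F : Type*} [Field F] (h2 : (2 : F) ≠ 0)
    {p : PowerSeries F} {u : F} (hu : u ≠ 0) (hp : PowerSeries.constantCoeff p = u ^ 2) :
    IsSquare p := by
  obtain ⟨s, hs, -⟩ := HenselianRing.is_henselian
    (I := Ideal.span {(PowerSeries.X : PowerSeries F)})
    (Polynomial.X ^ 2 - Polynomial.C p) (monic_X_pow_sub_C p two_ne_zero) (PowerSeries.C u)
    (by
      rw [Ideal.mem_span_singleton, PowerSeries.X_dvd_iff]
      simp [hp])
    (by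
      refine IsUnit.map _ (PowerSeries.isUnit_iff_constantCoeff.mpr ?_)
      simpa [one_add_one_eq_two, hu, map_ofNat] using h2)
  refine ⟨s, ?_⟩
  have hs' : s ^ 2 - p = 0 := by simpa [IsRoot] using hs
  rw [← sq, ← sub_eq_zero.mp hs']

namespace LaurentSeries

variable {F : Type*} [Field F]

theorem isSquare_of_even_order_of_isSquare_leadingCoeff (h2 : (2 : F) ≠ 0) {f : LaurentSeries F}
    (ho : Even f.order) (hl : IsSquare f.leadingCoeff) : IsSquare f := by
  rcases eq_or_ne f 0 with rfl | hf
  · exact IsSquare.zero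
  obtain ⟨u, hu⟩ := hl
  have hu0 : u ≠ 0 := by
    rintro rfl
    exact hf (HahnSeries.leadingCoeff_eq_zero.mp (by simpa using hu))
  obtain ⟨s, hs⟩ := PowerSeries.isSquare_of_constantCoeff_eq_sq h2 hu0 (p := f.powerSeriesPart) (by
    rw [← PowerSeries.coeff_zero_eq_constantCoeff_apply, powerSeriesPart_coeff, sq, ← hu,
      HahnSeries.leadingCoeff_eq]
    simp)
  obtain ⟨n, hn⟩ := ho
  refine ⟨HahnSeries.single n 1 * HahnSeries.ofPowerSeries ℤ F s, ?_⟩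
  rw [← single_order_mul_powerSeriesPart f, hs, hn, map_mul, mul_mul_mul_comm,
    HahnSeries.single_mul_single, one_mul]

theorem aeval_single_neg_one_eq_sum (p : F[X]) :
    aeval (HahnSeries.single (-1 : ℤ) (1 : F) : LaurentSeries F) p =
      p.sum fun n r => HahnSeries.single (-(n : ℤ)) r := by
  rw [aeval_eq_sum_range, sum_over_range _ (by simp)]
  refine Finset.sum_congr rfl fun n _ => ?_
  rw [HahnSeries.single_pow, Algebra.smul_def, HahnSeries.algebraMap_apply',
    PowerSeries.algebraMap_apply, HahnSeries.ofPowerSeries_C]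
  simp [HahnSeries.C_apply]

theorem coeff_aeval_single_neg_one (p : F[X]) (m : ℤ) :
    (aeval (HahnSeries.single (-1 : ℤ) (1 : F) : LaurentSeries F) p).coeff m =
      if m ≤ 0 then p.coeff (-m).toNat else 0 := by
  rw [aeval_single_neg_one_eq_sum, Polynomial.sum, HahnSeries.coeff_sum]
  simp only [HahnSeries.coeff_single]
  split_ifs with hm
  · rw [Finset.sum_eq_single (-m).toNat]
    · rw [if_pos (by omega)]
    · intro n _ hn
      rw [if_neg (by omega)]
    · intro hn
      simp [notMem_support_iff.mp hn]
  · exact Finset.sum_eq_zero fun n _ => if_neg (by omega)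

theorem aeval_single_neg_one_ne_zero {p : F[X]} (hp : p ≠ 0) :
    aeval (HahnSeries.single (-1 : ℤ) (1 : F) : LaurentSeries F) p ≠ 0 := by
  intro h
  have := coeff_aeval_single_neg_one p (-(p.natDegree : ℤ))
  simp [h] at this
  exact leadingCoeff_ne_zero.mpr hp this.symm

theorem order_aeval_single_neg_one (p : F[X]) :
    (aeval (HahnSeries.single (-1 : ℤ) (1 : F) : LaurentSeries F) p).order =
      -(p.natDegree : ℤ) := by
  rcases eq_or_ne p 0 with rfl | hp
  · simp
  refine le_antisymm (HahnSeries.order_le_of_coeff_ne_zero ?_) ?_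
  · simpa [coeff_aeval_single_neg_one] using hp
  · by_contra! h
    apply HahnSeries.coeff_order_eq_zero.not.mpr (aeval_single_neg_one_ne_zero hp)
    rw [coeff_aeval_single_neg_one, if_pos (by omega)]
    exact coeff_eq_zero_of_natDegree_lt (by omega)

theorem leadingCoeff_aeval_single_neg_one (p : F[X]) :
    (aeval (HahnSeries.single (-1 : ℤ) (1 : F) : LaurentSeries F) p).leadingCoeff =
      p.leadingCoeff := by
  rw [HahnSeries.leadingCoeff_eq, order_aeval_single_neg_one, coeff_aeval_single_neg_one]
  simp

theorem leadingCoeff_add_eq_zero_of_add_eq_zero {y z w : LaurentSeries F} (hy : y ≠ 0) (hz : z ≠ 0)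
    (h : y + z + w = 0) (hyw : w ≠ 0 → w.order ≠ y.order) (hzw : w ≠ 0 → w.order ≠ z.order) :
    y.leadingCoeff + z.leadingCoeff = 0 := by
  have hc (m : ℤ) : y.coeff m + z.coeff m + w.coeff m = 0 := by
    simpa using congrArg (fun f => HahnSeries.coeff f m) h
  have hw : w.coeff (min y.order z.order) = 0 := by
    by_contra hne
    have hw0 : w ≠ 0 := by rintro rfl; simp at hne
    have hle := HahnSeries.order_le_of_coeff_ne_zero hne
    have hyl : w.order < y.order := lt_of_le_of_ne (by omega) (hyw hw0)
    have hzl : w.order < z.order := lt_of_le_of_ne (by omega) (hzw hw0)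
    have := hc w.order
    rw [HahnSeries.coeff_eq_zero_of_lt_order hyl, HahnSeries.coeff_eq_zero_of_lt_order hzl,
      zero_add, zero_add, HahnSeries.coeff_order_eq_zero] at this
    exact hw0 this
  have hm := hc (min y.order z.order)
  rw [hw, add_zero] at hm
  have hy' := HahnSeries.coeff_order_eq_zero.not.mpr hy
  have hz' := HahnSeries.coeff_order_eq_zero.not.mpr hz
  rcases lt_trichotomy y.order z.order with hlt | heq | hlt
  · rw [min_eq_left hlt.le, HahnSeries.coeff_eq_zero_of_lt_order hlt, add_zero] at hm
    exact absurd hm hy'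
  · rw [← heq, min_self] at hm
    rwa [HahnSeries.leadingCoeff_eq, HahnSeries.leadingCoeff_eq, ← heq]
  · rw [min_eq_right hlt.le, HahnSeries.coeff_eq_zero_of_lt_order hlt, zero_add] at hm
    exact absurd hm hz'

theorem order_mul_sq {f g : LaurentSeries F} (hf : f ≠ 0) (hg : g ≠ 0) :
    (f * g ^ 2).order = f.order + 2 * g.order := by
  rw [HahnSeries.order_mul hf (pow_ne_zero 2 hg), sq, HahnSeries.order_mul hg hg, two_mul]

theorem leadingCoeff_mul_sq (f g : LaurentSeries F) :
    (f * g ^ 2).leadingCoeff = f.leadingCoeff * g.leadingCoeff ^ 2 := by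
  rw [sq, HahnSeries.leadingCoeff_mul, HahnSeries.leadingCoeff_mul, sq]

theorem isSquare_neg_leadingCoeff_mul_of_isotropic {A B C x y z : LaurentSeries F}
    (hA : A ≠ 0) (hB : B ≠ 0) (hC : C ≠ 0) (hAB : A.order % 2 = B.order % 2)
    (hAC : A.order % 2 ≠ C.order % 2) (hxyz : x ≠ 0 ∨ y ≠ 0 ∨ z ≠ 0)
    (h : A * x ^ 2 + B * y ^ 2 + C * z ^ 2 = 0) :
    IsSquare (-(A.leadingCoeff * B.leadingCoeff)) := by
  have eq_zero_and_eq_zero {D E u v : LaurentSeries F} (hD : D ≠ 0) (hE : E ≠ 0)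
      (hDE : D.order % 2 ≠ E.order % 2)
      (h : D * u ^ 2 + E * v ^ 2 = 0) : u = 0 ∧ v = 0 := by
    have huv : u = 0 ↔ v = 0 := by
      constructor <;> rintro rfl <;> simpa [hD, hE] using h
    by_contra hne
    have hu : u ≠ 0 := by tauto
    have hv : v ≠ 0 := by tauto
    have := congrArg HahnSeries.order (eq_neg_of_add_eq_zero_left h)
    rw [HahnSeries.order_neg, order_mul_sq hD hu, order_mul_sq hE hv] at this
    omega
  have hx : x ≠ 0 := by
    rintro rfl
    have := eq_zero_and_eq_zero hB hC (hAB ▸ hAC) (u := y) (v := z) (by simpa using h)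
    tauto
  have hy : y ≠ 0 := by
    rintro rfl
    have := eq_zero_and_eq_zero hA hC hAC (u := x) (v := z) (by simpa using h)
    tauto
  have hne {D u : LaurentSeries F} (hD : D ≠ 0) (hu : u ≠ 0) (hDC : D.order % 2 ≠ C.order % 2)
      (hw : C * z ^ 2 ≠ 0) : (C * z ^ 2).order ≠ (D * u ^ 2).order := by
    have hz : z ≠ 0 := by rintro rfl; simp at hw
    rw [order_mul_sq hC hz, order_mul_sq hD hu]
    omega
  have hlead := leadingCoeff_add_eq_zero_of_add_eq_zero (mul_ne_zero hA (pow_ne_zero 2 hx))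
    (mul_ne_zero hB (pow_ne_zero 2 hy)) h (hne hA hx hAC) (hne hB hy (hAB ▸ hAC))
  rw [leadingCoeff_mul_sq, leadingCoeff_mul_sq] at hlead
  have hy' : y.leadingCoeff ≠ 0 := HahnSeries.leadingCoeff_ne_zero.mpr hy
  refine ⟨A.leadingCoeff * x.leadingCoeff / y.leadingCoeff, ?_⟩
  field_simp
  linear_combination (-A.leadingCoeff) * hlead

theorem exists_isotropic_of_isSquare_neg_leadingCoeff_mul (h2 : (2 : F) ≠ 0)
    {A B : LaurentSeries F} (hA : A ≠ 0) (hB : B ≠ 0) (hAB : A.order % 2 = B.order % 2)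
    (h : IsSquare (-(A.leadingCoeff * B.leadingCoeff))) :
    ∃ x y : LaurentSeries F, x ≠ 0 ∧ A * x ^ 2 + B * y ^ 2 = 0 := by
  obtain ⟨s, hs⟩ := isSquare_of_even_order_of_isSquare_leadingCoeff h2 (f := -(A * B))
    (by
      rw [HahnSeries.order_neg, HahnSeries.order_mul hA hB, Int.even_iff]
      omega)
    (by rwa [HahnSeries.leadingCoeff_neg, HahnSeries.leadingCoeff_mul])
  exact ⟨B, s, hB, by linear_combination (-B) * hs⟩

end LaurentSeries

/-- If `deg(a_i) ≡ deg(a_j) (mod 2)` for some `i ≠ j` but the three degrees do not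
all have the same parity, then `a₁x₁² + a₂x₂² + a₃x₃² = 0` has a nontrivial solution in
`𝔽_q((1/t))` iff `−c_i c_j` is a square in `𝔽_q`, `c_i, c_j` the leading coefficients. -/
theorem stmt3 (Fq : Type) [Field Fq] [Fintype Fq] (hq : Odd (Fintype.card Fq))
    (a : Fin 3 → Polynomial Fq) (ha : ∀ k, a k ≠ 0)
    (i j : Fin 3) (hij : i ≠ j) (hpar : (a i).natDegree % 2 = (a j).natDegree % 2)
    (hnotall : ¬ ∀ k l, (a k).natDegree % 2 = (a l).natDegree % 2) :
    (∃ x : Fin 3 → LaurentSeries Fq, x ≠ 0 ∧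
        ∑ k, Polynomial.aeval ((HahnSeries.single (-1 : ℤ) (1 : Fq)) : LaurentSeries Fq) (a k)
          * x k ^ 2 = 0)
      ↔ IsSquare (-((a i).leadingCoeff * (a j).leadingCoeff)) := by
  have h2 : (2 : Fq) ≠ 0 := by
    refine Ring.two_ne_zero fun h => ?_
    have := FiniteField.even_card_of_char_two h
    rw [Nat.odd_iff] at hq
    omega
  obtain ⟨k, hki, hkj⟩ : ∃ k : Fin 3, k ≠ i ∧ k ≠ j :=
    (by decide : ∀ i j : Fin 3, ∃ k, k ≠ i ∧ k ≠ j) i j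
  have hcover (l : Fin 3) : l = i ∨ l = j ∨ l = k := by omega
  have hsum (f : Fin 3 → LaurentSeries Fq) : ∑ l, f l = f i + f j + f k := by
    have : (Finset.univ : Finset (Fin 3)) = {i, j, k} := by
      ext l; simpa using hcover l
    rw [this, Finset.sum_insert (by simp [hij, hki.symm]), Finset.sum_pair hkj.symm, add_assoc]
  have hik : (a i).natDegree % 2 ≠ (a k).natDegree % 2 := by
    intro h
    refine hnotall fun l m => ?_
    rcases hcover l with rfl | rfl | rfl <;> rcases hcover m with rfl | rfl | rfl <;> omega
  have hA (l : Fin 3) := LaurentSeries.aeval_single_neg_one_ne_zero (ha l)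
  have hord (l : Fin 3) := LaurentSeries.order_aeval_single_neg_one (a l)
  rw [← LaurentSeries.leadingCoeff_aeval_single_neg_one (a i),
    ← LaurentSeries.leadingCoeff_aeval_single_neg_one (a j)]
  constructor
  · rintro ⟨x, hx, h⟩
    rw [hsum] at h
    refine LaurentSeries.isSquare_neg_leadingCoeff_mul_of_isotropic (hA i) (hA j) (hA k)
      (by rw [hord, hord]; omega) (by rw [hord, hord]; omega) ?_ h
    by_contra! h0
    refine hx (funext fun l => ?_)
    rcases hcover l with rfl | rfl | rfl
    exacts [h0.1, h0.2.1, h0.2.2]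
  · intro h
    obtain ⟨x, y, hx, hxy⟩ := LaurentSeries.exists_isotropic_of_isSquare_neg_leadingCoeff_mul h2
      (hA i) (hA j) (by rw [hord, hord]; omega) h
    refine ⟨fun l => if l = i then x else if l = j then y else 0,
      fun h0 => hx (by simpa using congrFun h0 i), ?_⟩
    rw [hsum]
    simpa [hij.symm, hki, hkj] using hxy
end

section
/- Let a, m ∈ 𝔽_q[t] with deg(m) = M > 0 and gcd(a,m) = 1, and let N be a positive integer. Let S_N(a,m) be the number of monic irreducible polynomials f of degree N with f ≡ a (mod m), and let Φ(m) be the number of polynomials of degree less than M coprime to m. Then |S_N(a,m) − q^N/(Φ(m)·N)| ≤ (M+1)·q^{N/2}/N. -/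
set_option synthInstance.maxHeartbeats 1000000
set_option maxHeartbeats 1000000

open Polynomial

namespace Stepanov

open Module

section Filtration

variable {K R ι : Type*} [Field K] [CommRing R] [Algebra K R] [Algebra K[X] R]
  [IsScalarTower K K[X] R] [Fintype ι] (b : Basis ι K[X] R)

/-- Elements of `R` whose coordinates in the basis `b` have degree at most `d`. -/
def filt (d : ℕ) : Submodule K R where
  carrier := {w | ∀ i, (b.repr w i).natDegree ≤ d}
  add_mem' {v w} hv hw i := by
    simpa using (natDegree_add_le _ _).trans (max_le (hv i) (hw i))
  zero_mem' i := by simp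
  smul_mem' c w hw i := by
    have : b.repr (c • w) i = c • b.repr w i := by
      rw [← algebraMap_smul K[X] c w, map_smul, Finsupp.smul_apply, algebraMap_smul]
    rw [this]
    exact (natDegree_smul_le _ _).trans (hw i)

variable {b}

omit [Fintype ι] in
theorem filt_mono {d e : ℕ} (h : d ≤ e) : filt b d ≤ filt b e := fun _ hw i => (hw i).trans h

variable (b)

/-- The coordinates of elements of `filt b d`, as polynomials of bounded degree. -/
noncomputable def filtEquiv (d : ℕ) : filt b d ≃ₗ[K] (ι → degreeLT K (d + 1)) where
  toFun w i := ⟨b.repr w.1 i, by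
    rw [mem_degreeLT]
    exact degree_le_natDegree.trans_lt (by exact_mod_cast Nat.lt_succ_of_le (w.2 i))⟩
  map_add' v w := by ext i : 2; simp
  map_smul' c w := by
    ext i : 2
    simp only [SetLike.val_smul, RingHom.id_apply, Pi.smul_apply]
    rw [← algebraMap_smul K[X] c w.1, map_smul, Finsupp.smul_apply, algebraMap_smul]
  invFun c := ⟨∑ i, (c i : K[X]) • b i, fun i => by
    have h := (c i).2
    rw [mem_degreeLT] at h
    rw [b.repr_sum_self]
    rcases eq_or_ne (c i : K[X]) 0 with h0 | h0
    · simp [h0]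
    · exact Nat.lt_succ_iff.mp ((natDegree_lt_iff_degree_lt h0).2 h)⟩
  left_inv w := by
    ext
    simp [b.sum_repr]
  right_inv c := by
    ext i : 2
    simp only
    rw [b.repr_sum_self]

instance (d : ℕ) : FiniteDimensional K (filt b d) :=
  have : FiniteDimensional K (degreeLT K (d + 1)) := (degreeLTEquiv K (d + 1)).symm.finiteDimensional
  (filtEquiv b d).symm.finiteDimensional

theorem finrank_filt (d : ℕ) : finrank K (filt b d) = Fintype.card ι * (d + 1) := by
  have : FiniteDimensional K (degreeLT K (d + 1)) := (degreeLTEquiv K (d + 1)).symm.finiteDimensional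
  rw [(filtEquiv b d).finrank_eq, finrank_pi_fintype]
  simp [(degreeLTEquiv K (d + 1)).finrank_eq]

theorem exists_mem_filt (w : R) : ∃ d, w ∈ filt b d :=
  ⟨Finset.univ.sup fun i => (b.repr w i).natDegree,
    fun i => Finset.le_sup (f := fun i => (b.repr w i).natDegree) (Finset.mem_univ i)⟩

omit [Fintype ι] in
theorem smul_mem_filt {c : K[X]} {w : R} {d e : ℕ} (hc : c.natDegree ≤ d) (hw : w ∈ filt b e) :
    c • w ∈ filt b (d + e) := fun i => by
  simpa using natDegree_mul_le.trans (add_le_add hc (hw i))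

/-- A semilinear endomorphism raises degrees by a bounded amount. -/
theorem exists_map_mem_filt (σ : R →+* R) (s : K[X] →+* K[X])
    (hs : ∀ c, (s c).natDegree ≤ c.natDegree)
    (hσ : ∀ c, σ (algebraMap K[X] R c) = algebraMap K[X] R (s c)) :
    ∃ C, ∀ d, ∀ w ∈ filt b d, σ w ∈ filt b (d + C) := by
  choose e he using fun i => exists_mem_filt b (σ (b i))
  refine ⟨Finset.univ.sup e, fun d w hw => ?_⟩
  rw [← b.sum_repr w, map_sum]
  refine Submodule.sum_mem _ fun i _ => ?_
  rw [Algebra.smul_def, map_mul, hσ, ← Algebra.smul_def]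
  exact smul_mem_filt b ((hs _).trans (hw i))
    (filt_mono (Finset.le_sup (f := e) (Finset.mem_univ i)) (he i))

theorem exists_mul_mem_filt :
    ∃ C, ∀ d e, ∀ v ∈ filt b d, ∀ w ∈ filt b e, v * w ∈ filt b (d + e + C) := by
  choose e he using fun i : ι × ι => exists_mem_filt b (b i.1 * b i.2)
  refine ⟨Finset.univ.sup e, fun d d' v hv w hw => ?_⟩
  rw [← b.sum_repr v, ← b.sum_repr w, Finset.sum_mul_sum]
  refine Submodule.sum_mem _ fun i _ => Submodule.sum_mem _ fun j _ => ?_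
  rw [smul_mul_smul_comm]
  exact smul_mem_filt b (natDegree_mul_le.trans (add_le_add (hv i) (hw j)))
    (filt_mono (Finset.le_sup (f := e) (Finset.mem_univ (i, j))) (he (i, j)))

omit [Fintype ι] in
theorem pow_mem_filt {C : ℕ}
    (hC : ∀ d e, ∀ v ∈ filt b d, ∀ w ∈ filt b e, v * w ∈ filt b (d + e + C))
    {d : ℕ} {w : R} (hw : w ∈ filt b d) (s : ℕ) : w ^ (s + 1) ∈ filt b ((s + 1) * (d + C)) := by
  induction s with
  | zero => simpa using filt_mono (by omega) hw
  | succ s ih =>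
    rw [pow_succ]
    exact filt_mono (by ring_nf; omega) (hC _ _ _ ih _ hw)

theorem exists_natDegree_norm_le :
    ∃ C, ∀ d, ∀ w ∈ filt b d, (Algebra.norm K[X] w).natDegree ≤ Fintype.card ι * (d + C) := by
  classical
  obtain ⟨C, hC⟩ := exists_mul_mem_filt b
  choose e he using fun i : ι => exists_mem_filt b (b i)
  refine ⟨Finset.univ.sup e + C, fun d w hw => ?_⟩
  rw [Algebra.norm_eq_matrix_det b, Matrix.det_apply]
  refine natDegree_sum_le_of_forall_le _ _ fun τ _ => ?_
  refine (natDegree_smul_le _ _).trans ((natDegree_prod_le _ _).trans ?_)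
  rw [← Finset.card_univ, ← smul_eq_mul]
  refine Finset.sum_le_card_nsmul _ _ _ fun i _ => ?_
  rw [Algebra.leftMulMatrix_eq_repr_mul]
  have := hC _ _ _ hw _ (filt_mono (Finset.le_sup (f := e) (Finset.mem_univ i)) (he i)) (τ i)
  omega

omit [Algebra K R] [IsScalarTower K K[X] R] in
include b in
theorem dvd_algebraMap_norm (w : R) : w ∣ algebraMap K[X] R (Algebra.norm K[X] w) := by
  classical
  set A := Algebra.leftMulMatrix b w
  refine ⟨Matrix.toLin b b A.adjugate 1, ?_⟩
  have h1 : Matrix.toLin b b A = Algebra.lmul K[X] R w := by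
    simp [A, Algebra.leftMulMatrix_apply]
  have h2 : w * Matrix.toLin b b A.adjugate 1 = Matrix.toLin b b (A * A.adjugate) 1 := by
    rw [Matrix.toLin_mul b b b, h1]; rfl
  rw [h2, Matrix.mul_adjugate, ← Algebra.norm_eq_matrix_det, map_smul, Matrix.toLin_one,
    Algebra.algebraMap_eq_smul_one]
  rfl

include b in
/-- The number of geometric zeros of `w` is bounded by the degree of its norm. -/
theorem card_zeros_le [IsDomain R] {Ω : Type*} [Field Ω] [Algebra K Ω] {w : R} (hw : w ≠ 0) :
    {θ : R →ₐ[K] Ω | θ w = 0}.Finite ∧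
      {θ : R →ₐ[K] Ω | θ w = 0}.ncard ≤ (Algebra.norm K[X] w).natDegree := by
  have hfin : FiniteDimensional K (R ⧸ Ideal.span ({w} : Set R)) :=
    have h := Ideal.span_singleton_eq_bot.not.2 hw
    have := fun i => PowerBasis.finite (AdjoinRoot.powerBasis (Ideal.smithCoeffs_ne_zero b _ h i))
    (Ideal.quotientEquivDirectSum K b h).symm.finiteDimensional
  let e : {θ : R →ₐ[K] Ω // θ w = 0} → (R ⧸ Ideal.span ({w} : Set R) →ₐ[K] Ω) := fun θ =>
    Ideal.Quotient.liftₐ _ θ.1 fun a ha => by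
      obtain ⟨c, rfl⟩ := Ideal.mem_span_singleton'.1 ha
      rw [map_mul, θ.2, mul_zero]
  have he : Function.Injective e := fun θ θ' h => by
    ext x
    exact DFunLike.congr_fun h (Ideal.Quotient.mk _ x)
  have hf : Finite {θ : R →ₐ[K] Ω // θ w = 0} := Finite.of_injective e he
  refine ⟨hf, ?_⟩
  rw [← finrank_quotient_span_eq_natDegree_norm b hw]
  exact (Nat.card_le_card_of_injective e he).trans (card_algHom_le_finrank K _ _)

end Filtration

section Frobenius

variable (K : Type*) [Field K] [Fintype K] {L : Type*} [CommRing L] [Algebra K L]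

/-- The `k`-th power of the `K`-Frobenius of a commutative `K`-algebra. -/
noncomputable def frob (L : Type*) [CommRing L] [Algebra K L] (k : ℕ) : L →ₐ[K] L :=
  FiniteField.frobeniusAlgHom K L ^ k

theorem frob_apply (k : ℕ) (x : L) : frob K L k x = x ^ Fintype.card K ^ k := by
  rw [frob, AlgHom.coe_pow, FiniteField.coe_frobeniusAlgHom, pow_iterate]

end Frobenius

section Core

variable {K : Type*} [Field K] [Fintype K]

/-- Power series which stay independent modulo `X ^ Q` are linearly independent over the
field of `Q`-th powers. -/
theorem eq_zero_of_sum_mul_pow_eq_zero {β : Type*} [Fintype β] (k : ℕ) (f g : β → PowerSeries K)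
    (hf : ∀ c : β → K, PowerSeries.X ^ Fintype.card K ^ k ∣ ∑ j, c j • f j → c = 0)
    (hg : ∑ j, f j * g j ^ Fintype.card K ^ k = 0) : g = 0 := by
  classical
  set Q := Fintype.card K ^ k with hQ
  by_contra hne
  have hex : ∃ e, ∃ j, PowerSeries.coeff e (g j) ≠ 0 := by
    by_contra! h
    exact hne (funext fun j => PowerSeries.ext fun e => by simpa using h e j)
  let e := Nat.find hex
  have hdvd : ∀ j, PowerSeries.X ^ e ∣ g j := fun j =>
    PowerSeries.X_pow_dvd_iff.2 fun i hi => by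
      have := Nat.find_min hex hi
      push Not at this
      exact this j
  choose g' hg' using hdvd
  obtain ⟨j₀, hj₀⟩ := Nat.find_spec hex
  have hsum : ∑ j, f j * g' j ^ Q = 0 := by
    have : PowerSeries.X ^ (e * Q) * ∑ j, f j * g' j ^ Q = 0 := by
      rw [← hg, Finset.mul_sum]
      refine Finset.sum_congr rfl fun j _ => ?_
      rw [hg' j, mul_pow, ← pow_mul]
      ring
    exact (mul_eq_zero.1 this).resolve_left (pow_ne_zero _ PowerSeries.X_ne_zero)
  have hpow : ∀ j, ∃ h, g' j ^ Q =
      algebraMap K _ (PowerSeries.constantCoeff (g' j)) + PowerSeries.X ^ Q * h := fun j => by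
    obtain ⟨h, hh⟩ := PowerSeries.X_dvd_iff.2
      (show PowerSeries.constantCoeff (g' j - algebraMap K _ (PowerSeries.constantCoeff (g' j))) = 0
        by simp)
    refine ⟨h ^ Q, ?_⟩
    conv_lhs => rw [sub_eq_iff_eq_add'.1 hh]
    rw [hQ, ← frob_apply, map_add, AlgHom.commutes, frob_apply, mul_pow]
  choose h hh using hpow
  have hc := hf (fun j => PowerSeries.constantCoeff (g' j)) ⟨- ∑ j, f j * h j, by
    have : ∑ j, (PowerSeries.constantCoeff (g' j)) • f j
        + PowerSeries.X ^ Q * ∑ j, f j * h j = 0 := by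
      rw [← hsum, Finset.mul_sum, ← Finset.sum_add_distrib]
      refine Finset.sum_congr rfl fun j _ => ?_
      rw [hh j, Algebra.smul_def]
      ring
    rw [mul_neg]
    exact eq_neg_of_add_eq_zero_left this⟩
  apply hj₀
  have h0 : PowerSeries.coeff e (g j₀) = PowerSeries.constantCoeff (g' j₀) := by
    rw [hg' j₀]
    simpa using PowerSeries.coeff_X_pow_mul (g' j₀) e 0
  exact h0.trans (congrFun hc j₀)

variable {R ι : Type*} [CommRing R] [IsDomain R] [Algebra K R] [Algebra K[X] R]
  [IsScalarTower K K[X] R] [Fintype ι] (b : Basis ι K[X] R)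

omit [Fintype K] [Algebra K R] [IsScalarTower K K[X] R] in
include b in
/-- The vanishing order of a function along a power series branch is at most the degree of its
norm. -/
theorem le_natDegree_norm_of_X_pow_dvd (emb : R →ₐ[K[X]] PowerSeries K) {w : R} (hw : w ≠ 0) {e : ℕ}
    (he : PowerSeries.X ^ e ∣ emb w) : e ≤ (Algebra.norm K[X] w).natDegree := by
  have := Module.Free.of_basis b
  have hN : Algebra.norm K[X] w ≠ 0 := by
    have := Module.Finite.of_basis b
    exact Algebra.norm_ne_zero_iff.2 hw
  have hd : PowerSeries.X ^ e ∣ ((Algebra.norm K[X] w : K[X]) : PowerSeries K) := by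
    have h1 := map_dvd emb (dvd_algebraMap_norm b w)
    rw [AlgHom.commutes, PowerSeries.algebraMap_apply', Algebra.algebraMap_self,
      PowerSeries.map_id] at h1
    exact he.trans h1
  by_contra! hlt
  have h2 := PowerSeries.X_pow_dvd_iff.1 hd _ hlt
  rw [Polynomial.coeff_coe, coeff_natDegree] at h2
  exact hN (leadingCoeff_eq_zero.1 h2)

/-- Stepanov's auxiliary function: an element of `R` of controlled degree killed by every point on
which the `2 * k`-th Frobenius power acts as `σ`. -/
theorem exists_auxiliary (emb : R →ₐ[K[X]] PowerSeries K) (hemb : Function.Injective emb)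
    (σ : R →ₐ[K] R) {C : ℕ}
    (hmul : ∀ d e, ∀ v ∈ filt b d, ∀ w ∈ filt b e, v * w ∈ filt b (d + e + C))
    (hσ : ∀ d, ∀ w ∈ filt b d, σ w ∈ filt b (d + C))
    (hnorm : ∀ d, ∀ w ∈ filt b d,
      (Algebra.norm K[X] w).natDegree ≤ Fintype.card ι * (d + C))
    (k d e : ℕ) (hd : Fintype.card ι * (d + C) < Fintype.card K ^ k)
    (hdim : Fintype.card ι * (Fintype.card K ^ k * (d + C) + (e + C) + C + 1) <
      Fintype.card ι * (d + 1) * (Fintype.card ι * (e + 1))) :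
    ∃ h : R, h ≠ 0 ∧ h ∈ filt b (d + Fintype.card K ^ k * (e + C) + C) ∧
      ∀ {Ω : Type*} [Field Ω] [Algebra K Ω] (θ : R →ₐ[K] Ω),
        (∀ w, θ w ^ Fintype.card K ^ (2 * k) = θ (σ w)) → θ h = 0 := by
  set Q := Fintype.card K ^ k with hQ
  obtain ⟨Q', hQ'⟩ : ∃ Q', Q = Q' + 1 :=
    Nat.exists_eq_succ_of_ne_zero (pow_ne_zero _ Fintype.card_ne_zero)
  let v := finBasis K (filt b d)
  let T := filt b (Q * (d + C) + (e + C) + C)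
  have hvT : ∀ i (u : filt b e), (v i : R) ^ Q * σ u ∈ T := fun i u => by
    refine hmul _ _ _ ?_ _ (hσ _ _ u.2)
    rw [hQ']
    exact pow_mem_filt b hmul (v i).2 Q'
  let Λ : (Fin (finrank K (filt b d)) → filt b e) →ₗ[K] T :=
    ∑ i, (LinearMap.codRestrict T
      ((LinearMap.mulLeft K ((v i : R) ^ Q)) ∘ₗ σ.toLinearMap ∘ₗ (filt b e).subtype)
      (fun u => hvT i u)) ∘ₗ LinearMap.proj i
  have hΛ : ∀ u, ((Λ u : T) : R) = ∑ i, (v i : R) ^ Q * σ (u i) := fun u => by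
    simp [Λ, LinearMap.sum_apply]
    rfl
  have hker : LinearMap.ker Λ ≠ ⊥ := by
    refine LinearMap.ker_ne_bot_of_finrank_lt ?_
    rw [finrank_pi_fintype]
    simp only [T, finrank_filt, Finset.sum_const, Finset.card_univ, Fintype.card_fin, smul_eq_mul]
    exact hdim
  obtain ⟨u, hu, hu0⟩ := (Submodule.ne_bot_iff _).1 hker
  have hu' : ∑ i, (v i : R) ^ Q * σ (u i) = 0 := by
    rw [← hΛ, LinearMap.mem_ker.1 hu]; rfl
  refine ⟨∑ i, (v i : R) * (u i : R) ^ Q, fun h0 => hu0 ?_, ?_, fun {Ω} _ _ θ hθ => ?_⟩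
  · have := eq_zero_of_sum_mul_pow_eq_zero k (fun i => emb (v i)) (fun i => emb (u i)) ?_ ?_
    · ext i
      have h1 := congrFun this i
      simpa using hemb (h1.trans (map_zero emb).symm)
    · intro c hc
      have hcomb : ∑ i, c i • emb (v i) = emb ((∑ i, c i • v i : filt b d) : R) := by
        push_cast
        rw [map_sum]
        refine Finset.sum_congr rfl fun i _ => ?_
        rw [← algebraMap_smul K[X] (c i) ((v i : R)), map_smul, algebraMap_smul]
      rw [hcomb] at hc
      have hz : (∑ i, c i • v i : filt b d) = 0 := by
        by_contra hne
        have hne' : ((∑ i, c i • v i : filt b d) : R) ≠ 0 := fun h => hne (Subtype.ext h)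
        exact absurd (le_natDegree_norm_of_X_pow_dvd b emb hne' hc)
          (not_le.2 ((hnorm _ _ (∑ i, c i • v i : filt b d).2).trans_lt hd))
      exact funext (Fintype.linearIndependent_iff.1 v.linearIndependent c hz)
    · simpa using congrArg emb h0
  · refine Submodule.sum_mem _ fun i _ => hmul _ _ _ (v i).2 _ ?_
    rw [hQ']
    exact pow_mem_filt b hmul (u i).2 Q'
  · have h1 : θ (∑ i, (v i : R) * (u i : R) ^ Q) ^ Q = 0 := by
      rw [hQ, ← frob_apply, map_sum, map_sum, ← map_zero θ, ← hu', map_sum]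
      refine Finset.sum_congr rfl fun i _ => ?_
      rw [frob_apply, map_mul, mul_pow, map_pow, ← pow_mul, ← pow_add, ← two_mul, hθ, map_mul,
        map_pow]
    exact eq_zero_of_pow_eq_zero h1

include b in
/-- **Stepanov's bound** on the points of a curve on which a Frobenius power acts as a fixed
automorphism. -/
theorem exists_ncard_fixed_le (emb : R →ₐ[K[X]] PowerSeries K) (hemb : Function.Injective emb)
    (σ : R →ₐ[K] R) (s : K[X] →+* K[X]) (hs : ∀ c, (s c).natDegree ≤ c.natDegree)
    (hσs : ∀ c, σ (algebraMap K[X] R c) = algebraMap K[X] R (s c))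
    (Ω : Type*) [Field Ω] [Algebra K Ω] :
    ∃ C k₀ : ℕ, ∀ k ≥ k₀,
      {θ : R →ₐ[K] Ω | ∀ w, θ w ^ Fintype.card K ^ (2 * k) = θ (σ w)}.Finite ∧
      {θ : R →ₐ[K] Ω | ∀ w, θ w ^ Fintype.card K ^ (2 * k) = θ (σ w)}.ncard ≤
        Fintype.card K ^ (2 * k) + C * Fintype.card K ^ k := by
  obtain ⟨C₁, h₁⟩ := exists_mul_mem_filt b
  obtain ⟨C₂, h₂⟩ := exists_map_mem_filt b (σ : R →+* R) s hs hσs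
  obtain ⟨C₃, h₃⟩ := exists_natDegree_norm_le b
  set C := C₁ + C₂ + C₃ with hC
  set n := Fintype.card ι with hn
  have hn0 : 0 < n := by
    have := b.index_nonempty
    exact Fintype.card_pos
  have hmul : ∀ d e, ∀ v ∈ filt b d, ∀ w ∈ filt b e, v * w ∈ filt b (d + e + C) :=
    fun d e v hv w hw => filt_mono (by omega) (h₁ d e v hv w hw)
  have hσ : ∀ d, ∀ w ∈ filt b d, σ w ∈ filt b (d + C) :=
    fun d w hw => filt_mono (by omega) (h₂ d w hw)
  have hnorm : ∀ d, ∀ w ∈ filt b d, (Algebra.norm K[X] w).natDegree ≤ n * (d + C) :=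
    fun d w hw => (h₃ d w hw).trans (Nat.mul_le_mul_left _ (by omega))
  have hq : 1 < Fintype.card K := Fintype.one_lt_card
  refine ⟨1 + n * C + n * (2 * C + 1), n * (n * C * (C + 2) + 3 * C + 4 + C + 1), fun k hk => ?_⟩
  set Q := Fintype.card K ^ k with hQ
  have hkQ : k < Q := Nat.lt_pow_self hq
  set A := Q / n with hA
  have hA1 : n * A ≤ Q := Nat.mul_div_le Q n
  have hA2 : Q < n * (A + 1) := Nat.lt_mul_div_succ Q hn0
  have hA3 : n * C * (C + 2) + 3 * C + 4 + C + 1 ≤ A := by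
    rw [hA, Nat.le_div_iff_mul_le hn0, mul_comm]; omega
  obtain ⟨d, hd⟩ : ∃ d, A = d + C + 1 := ⟨A - C - 1, by omega⟩
  have hnd : n * (d + C) < Q := by
    refine lt_of_lt_of_le ?_ hA1
    exact Nat.mul_lt_mul_of_pos_left (by omega) hn0
  obtain ⟨h, h0, hh, hz⟩ := exists_auxiliary b emb hemb σ hmul hσ hnorm k d (A + C + 1) hnd (by
    rw [← hn, ← hQ, mul_assoc]
    refine Nat.mul_lt_mul_of_pos_left ?_ hn0
    have e1 : Q * (d + C) ≤ n * (A + 1) * (d + C) := Nat.mul_le_mul_right _ hA2.le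
    nlinarith)
  obtain ⟨hf, hcard⟩ := card_zeros_le (Ω := Ω) b h0
  have hsub : {θ : R →ₐ[K] Ω | ∀ w, θ w ^ Fintype.card K ^ (2 * k) = θ (σ w)} ⊆
      {θ : R →ₐ[K] Ω | θ h = 0} := fun θ hθ => hz θ hθ
  refine ⟨hf.subset hsub, (Set.ncard_le_ncard hsub hf).trans (hcard.trans ((hnorm _ _ hh).trans ?_))⟩
  rw [← hQ, two_mul, pow_add, ← hQ]
  have e2 : Q * (n * A) ≤ Q * Q := Nat.mul_le_mul_left _ hA1
  have e3 : n * C * 1 ≤ n * C * Q := Nat.mul_le_mul_left _ (by omega)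
  calc n * (d + Q * (A + C + 1 + C) + C + C)
      = n * (d + C) + Q * (n * A) + n * (2 * C + 1) * Q + n * C * 1 := by ring
    _ ≤ Q + Q * Q + n * (2 * C + 1) * Q + n * C * Q := by omega
    _ = _ := by ring

end Core

section Series

variable {F n : Type*} [Field F] [Fintype F] [Fintype n] [DecidableEq n]

/-- The coefficients of the solution of `Y⁽ᵠ⁾ = (1 + z ^ (q - 1) T) Y`. -/
noncomputable def coeffSeq (T : Matrix n n F) : ℕ → Matrix n n F
  | 0 => 1
  | k + 1 =>
    have _hq : 1 < Fintype.card F := Fintype.one_lt_card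
    (if Fintype.card F ∣ k + 1 then coeffSeq T ((k + 1) / Fintype.card F) else 0) -
      (if Fintype.card F - 1 ≤ k + 1 then T * coeffSeq T (k + 1 - (Fintype.card F - 1)) else 0)
decreasing_by
  · exact Nat.div_lt_self (Nat.succ_pos k) _hq
  · omega

theorem coeffSeq_add (T : Matrix n n F) (k : ℕ) :
    coeffSeq T k +
      (if Fintype.card F - 1 ≤ k then T * coeffSeq T (k - (Fintype.card F - 1)) else 0) =
      if Fintype.card F ∣ k then coeffSeq T (k / Fintype.card F) else 0 := by
  have : 1 < Fintype.card F := Fintype.one_lt_card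
  cases k with
  | zero => rw [if_neg (by omega)]; simp
  | succ k => rw [coeffSeq, sub_add_cancel]

theorem coeff_pow_card (f : PowerSeries F) (k : ℕ) :
    PowerSeries.coeff k (f ^ Fintype.card F) =
      if Fintype.card F ∣ k then PowerSeries.coeff (k / Fintype.card F) f else 0 := by
  have h := congrArg (Polynomial.coeff · k) (PowerSeries.trunc_trunc_pow f (k + 1) (Fintype.card F))
  simp only [PowerSeries.coeff_trunc, Nat.lt_succ_self, if_true] at h
  rw [← h, ← Polynomial.coe_pow, Polynomial.coeff_coe, ← FiniteField.expand_card,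
    Polynomial.coeff_expand Fintype.card_pos]
  split_ifs with hd
  · rw [PowerSeries.coeff_trunc, if_pos (Nat.lt_succ_of_le (Nat.div_le_self _ _))]
  · rfl

/-- A matrix of power series with `Y⁽ᵠ⁾ = (1 + z ^ (q - 1) T) Y` and constant coefficient `1`. -/
noncomputable def seriesMatrix (T : Matrix n n F) : Matrix n n (PowerSeries F) :=
  fun i j => PowerSeries.mk fun k => coeffSeq T k i j

theorem seriesMatrix_pow (T : Matrix n n F) (i j : n) :
    seriesMatrix T i j ^ Fintype.card F = seriesMatrix T i j +
      PowerSeries.X ^ (Fintype.card F - 1) * ∑ l, algebraMap F _ (T i l) * seriesMatrix T l j := by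
  ext k
  have h := congrFun (congrFun (coeffSeq_add T k) i) j
  rw [coeff_pow_card, map_add, PowerSeries.coeff_X_pow_mul', map_sum]
  simp only [seriesMatrix, PowerSeries.coeff_mk, PowerSeries.algebraMap_apply, Algebra.algebraMap_self_apply,
    PowerSeries.coeff_C_mul]
  rw [Matrix.add_apply] at h
  split_ifs at h ⊢ <;> simpa [Matrix.mul_apply] using h.symm

theorem det_seriesMatrix_ne_zero (T : Matrix n n F) : (seriesMatrix T).det ≠ 0 := by
  intro h
  have h1 := congrArg (PowerSeries.constantCoeff) h
  rw [RingHom.map_det, map_zero] at h1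
  have : (PowerSeries.constantCoeff (R := F)).mapMatrix (seriesMatrix T) = 1 := by
    ext i j
    simp [seriesMatrix, coeffSeq]
  rw [this, Matrix.det_one] at h1
  exact one_ne_zero h1

end Series

section Finite

/-- An algebra generated by finitely many elements whose `q`-th powers are linear combinations of
these elements is finite. -/
theorem finite_adjoin_of_pow_mem_span {A S ι : Type*} [CommRing A] [IsNoetherianRing A] [CommRing S]
    [Algebra A S] [Finite ι] (y : ι → S) {q : ℕ} (hq : 1 < q)
    (hy : ∀ i, y i ^ q ∈ Submodule.span A (Set.range y)) :
    Module.Finite A (Algebra.adjoin A (Set.range y)) := by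
  classical
  have := Fintype.ofFinite ι
  let N := Submodule.span A (Set.range fun e : ι → Fin q => ∏ i, y i ^ (e i : ℕ))
  have hmon : ∀ d, ∀ s : ι →₀ ℕ, s.sum (fun _ e => e) = d → ∏ i, y i ^ s i ∈ N := by
    intro d
    induction d using Nat.strong_induction_on with
    | _ d ih =>
    intro s hs
    by_cases hlt : ∀ i, s i < q
    · exact Submodule.subset_span ⟨fun i => ⟨s i, hlt i⟩, rfl⟩
    push Not at hlt
    obtain ⟨i, hi⟩ := hlt
    obtain ⟨s', rfl⟩ : ∃ s', s = s' + Finsupp.single i q :=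
      ⟨s - Finsupp.single i q, (tsub_add_cancel_of_le (by simpa using hi)).symm⟩
    have hsplit : ∀ j e, ∏ l, y l ^ (s' + Finsupp.single j e) l = (∏ l, y l ^ s' l) * y j ^ e := by
      intro j e
      simp only [Finsupp.add_apply, pow_add, Finset.prod_mul_distrib]
      congr 1
      rw [Finset.prod_eq_single j] <;> simp +contextual [eq_comm]
    have hdeg : ∀ j e, (s' + Finsupp.single j e).sum (fun _ e => e) = s'.sum (fun _ e => e) + e := by
      intro j e
      rw [Finsupp.sum_add_index' (by simp) (by simp)]
      simp
    rw [hsplit]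
    obtain ⟨c, hc⟩ := (Submodule.mem_span_range_iff_exists_fun A).1 (hy i)
    rw [← hc, Finset.mul_sum]
    refine Submodule.sum_mem _ fun j _ => ?_
    rw [mul_smul_comm]
    refine Submodule.smul_mem _ _ ?_
    have := ih _ (by rw [← hs, hdeg]; exact Nat.add_lt_add_left hq _) _ (hdeg j 1)
    rwa [hsplit, pow_one] at this
  have hle : Subalgebra.toSubmodule (Algebra.adjoin A (Set.range y)) ≤ N := by
    intro w hw
    rw [Subalgebra.mem_toSubmodule, Algebra.adjoin_range_eq_range_aeval] at hw
    obtain ⟨p, rfl⟩ := hw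
    change MvPolynomial.aeval y p ∈ N
    rw [MvPolynomial.aeval_def, MvPolynomial.eval₂_eq']
    refine Submodule.sum_mem _ fun s _ => ?_
    rw [← Algebra.smul_def]
    exact Submodule.smul_mem _ _ (hmon _ s rfl)
  have hN : Module.Finite A N := Module.Finite.span_of_finite A (Set.finite_range _)
  have : IsNoetherian A (Subalgebra.toSubmodule (Algebra.adjoin A (Set.range y))) :=
    isNoetherian_of_le hle
  exact Module.IsNoetherian.finite A (Subalgebra.toSubmodule (Algebra.adjoin A (Set.range y)))

end Finite

section Points

variable {F n B : Type*} [Field F] [Fintype F] [Fintype n] [DecidableEq n] [CommRing B] [Algebra F B]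
  (ρ : B →ₐ[F] Matrix n n F) (t : B)

/-- A matrix representation with scalars extended to `S`. -/
noncomputable def extRep (S : Type*) [CommRing S] [Algebra F S] : B →ₐ[F] Matrix n n S :=
  (Algebra.ofId F S).mapMatrix.comp ρ

omit [Fintype F] in
theorem mapMatrix_extRep {S S' : Type*} [CommRing S] [Algebra F S] [CommRing S'] [Algebra F S']
    (φ : S →ₐ[F] S') (b : B) : φ.mapMatrix (extRep ρ S b) = extRep ρ S' b := by
  ext i j
  simp [extRep, Algebra.ofId_apply]

omit [Fintype F] in
theorem extRep_injective (hρ : Function.Injective ρ) (S : Type*) [CommRing S] [Nontrivial S]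
    [Algebra F S] : Function.Injective (extRep ρ S) := by
  intro b b' h
  apply hρ
  ext i j
  have := congrFun (congrFun h i) j
  simpa [extRep, Algebra.ofId_apply] using this

variable {R : Type*} [CommRing R] [Algebra F R] (z : R) (Y : Matrix n n R)

/-- The endomorphism `z ↦ c z`, `Y ↦ b Y` followed by the point `θ`. -/
def IsTwist {S : Type*} [CommRing S] [Algebra F S] (θ σ : R →ₐ[F] S) (γ : Fˣ × Bˣ) : Prop :=
  σ z = (γ.1 : F) • θ z ∧ σ.mapMatrix Y = extRep ρ S (γ.2 : B) * θ.mapMatrix Y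

variable {ρ z Y}

omit [Fintype F] in
theorem IsTwist.comp {S : Type*} [CommRing S] [Algebra F S] {σ : R →ₐ[F] R} {γ : Fˣ × Bˣ}
    (h : IsTwist ρ z Y (AlgHom.id F R) σ γ) (θ : R →ₐ[F] S) : IsTwist ρ z Y θ (θ.comp σ) γ := by
  refine ⟨?_, ?_⟩
  · simp [h.1]
  · have := congrArg θ.mapMatrix h.2
    rw [map_mul, mapMatrix_extRep] at this
    simpa [AlgHom.mapMatrix_comp] using this

omit [Fintype F] in
theorem IsTwist.trans {S : Type*} [CommRing S] [Algebra F S] {θ φ σ : R →ₐ[F] S} {γ γ' : Fˣ × Bˣ}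
    (h : IsTwist ρ z Y θ φ γ) (h' : IsTwist ρ z Y φ σ γ') : IsTwist ρ z Y θ σ (γ' * γ) := by
  refine ⟨?_, ?_⟩
  · rw [h'.1, h.1, smul_smul]; rfl
  · rw [h'.2, h.2, ← mul_assoc, ← map_mul]; rfl

omit [Fintype F] in
theorem IsTwist.of_commute {S : Type*} [CommRing S] [Algebra F S] {θ θ' φ φ' : R →ₐ[F] S}
    {γ γ' : Fˣ × Bˣ} (h : IsTwist ρ z Y θ φ γ) (hθ : IsTwist ρ z Y θ θ' γ')
    (hφ : IsTwist ρ z Y φ φ' γ') : IsTwist ρ z Y θ' φ' γ := by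
  refine ⟨?_, ?_⟩
  · rw [hφ.1, h.1, hθ.1, smul_comm]
  · rw [hφ.2, h.2, hθ.2, ← mul_assoc, ← mul_assoc, ← map_mul, ← map_mul, mul_comm (γ.2 : B)]

variable (ρ z Y)

/-- The group of twists realized by endomorphisms of `R`. -/
def twistGroup [Finite B] : Subgroup (Fˣ × Bˣ) where
  carrier := {γ | ∃ σ : R →ₐ[F] R, IsTwist ρ z Y (AlgHom.id F R) σ γ}
  one_mem' := ⟨AlgHom.id F R, by constructor <;> simp⟩
  mul_mem' := by
    rintro γ γ' ⟨σ, h⟩ ⟨σ', h'⟩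
    refine ⟨σ'.comp σ, ?_⟩
    have := h'.trans (h.comp σ')
    simpa using this
  inv_mem' := by
    rintro γ ⟨σ, h⟩
    have hpow : ∀ k : ℕ, ∃ σ : R →ₐ[F] R, IsTwist ρ z Y (AlgHom.id F R) σ (γ ^ k) := by
      intro k
      induction k with
      | zero => exact ⟨AlgHom.id F R, by constructor <;> simp⟩
      | succ k ih =>
        obtain ⟨σ', h'⟩ := ih
        exact ⟨σ'.comp σ, by rw [pow_succ']; exact h'.trans (h.comp σ')⟩
    have : γ⁻¹ = γ ^ (orderOf γ - 1) := by
      rw [inv_eq_iff_mul_eq_one, ← pow_succ', Nat.sub_add_cancel (orderOf_pos γ), pow_orderOf_eq_one]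
    rw [Set.mem_ofPred_eq, this]
    exact hpow _

variable {ρ z Y}

section Generators

variable (hgen : Algebra.adjoin F ({z} ∪ Set.range fun p : n × n => Y p.1 p.2) = ⊤)

include hgen

omit [Fintype F] [DecidableEq n] [Fintype n] in
theorem algHom_ext_of_gen {S : Type*} [CommRing S] [Algebra F S] {θ σ : R →ₐ[F] S} (hz : θ z = σ z)
    (hY : ∀ i j, θ (Y i j) = σ (Y i j)) : θ = σ := by
  refine AlgHom.ext_of_adjoin_eq_top hgen ?_
  rintro _ (rfl | ⟨p, rfl⟩)
  · exact hz
  · exact hY _ _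

omit [Fintype F] in
theorem IsTwist.unique {S : Type*} [CommRing S] [Algebra F S] {θ σ σ' : R →ₐ[F] S} {γ : Fˣ × Bˣ}
    (h : IsTwist ρ z Y θ σ γ) (h' : IsTwist ρ z Y θ σ' γ) : σ = σ' := by
  refine algHom_ext_of_gen hgen (h.1.trans h'.1.symm) fun i j => ?_
  exact congrFun (congrFun (h.2.trans h'.2.symm) i) j

/-- If a twist is not realized by an endomorphism then the points realizing it satisfy a nontrivial
equation. -/
theorem exists_ne_zero_of_not_mem_twistGroup [Finite B] {γ : Fˣ × Bˣ}
    (hγ : γ ∉ twistGroup ρ z Y) : ∃ w : R, w ≠ 0 ∧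
      ∀ {S : Type*} [CommRing S] [Algebra F S] (θ σ : R →ₐ[F] S), IsTwist ρ z Y θ σ γ → θ w = 0 := by
  let g : Option (n × n) → R := fun o => o.elim z fun p => Y p.1 p.2
  let g' : Option (n × n) → R := fun o =>
    o.elim ((γ.1 : F) • z) fun p => (extRep ρ R (γ.2 : B) * Y) p.1 p.2
  have hsurj : Function.Surjective (MvPolynomial.aeval (R := F) g) := by
    rw [← AlgHom.range_eq_top, ← Algebra.adjoin_range_eq_range_aeval, ← hgen]
    congr 1
    ext w
    simp [g, Option.exists, eq_comm]
  have hker : ¬ ∀ p, MvPolynomial.aeval (R := F) g p = 0 → MvPolynomial.aeval (R := F) g' p = 0 := by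
    intro hk
    apply hγ
    let e := Ideal.quotientKerAlgEquivOfSurjective hsurj
    let σ : R →ₐ[F] R := (Ideal.Quotient.liftₐ (RingHom.ker (MvPolynomial.aeval (R := F) g))
      (MvPolynomial.aeval (R := F) g') hk).comp e.symm.toAlgHom
    have hσ : ∀ p, σ (MvPolynomial.aeval (R := F) g p) = MvPolynomial.aeval (R := F) g' p := by
      intro p
      have : e.symm (MvPolynomial.aeval (R := F) g p) = Ideal.Quotient.mk _ p := by
        rw [AlgEquiv.symm_apply_eq]; rfl
      simp only [σ, AlgHom.comp_apply]
      erw [this]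
      rfl
    refine ⟨σ, ?_, ?_⟩
    · simpa [g, g'] using hσ (MvPolynomial.X none)
    · ext i j
      simpa [g, g'] using hσ (MvPolynomial.X (some (i, j)))
  push Not at hker
  obtain ⟨p, hp, hp'⟩ := hker
  refine ⟨_, hp', fun θ σ h => ?_⟩
  have : θ.comp (MvPolynomial.aeval g') = σ.comp (MvPolynomial.aeval g) := by
    ext o
    rcases o with _ | ⟨i, j⟩
    · simpa [g, g'] using h.1.symm
    · have e : θ.mapMatrix (extRep ρ R (γ.2 : B) * Y) = σ.mapMatrix Y := by
        rw [map_mul, mapMatrix_extRep, h.2]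
      simp only [AlgHom.comp_apply, MvPolynomial.aeval_X, g, g', Option.elim]
      exact congrFun (congrFun e i) j
  have h2 := DFunLike.congr_fun this p
  simpa [hp] using h2

end Generators

/-- The number `x` is a nonzero point fixed by the `N`-th Frobenius power, and `γ` records the
values at `0` and `t` of the norm polynomial of `x`. -/
def IsGood {Ω : Type*} [Field Ω] [Algebra F Ω] (t : B) (N : ℕ) (γ : Fˣ × Bˣ) (x : Ω) : Prop :=
  x ≠ 0 ∧ x ^ Fintype.card F ^ N = x ∧ ∃ f : F[X],
    f.map (algebraMap F Ω) = ∏ i ∈ Finset.range N, (X - C (x ^ Fintype.card F ^ i)) ∧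
    f.eval 0 = γ.1 ∧ aeval t f = γ.2

/-- The twist attached to the values at `0` and `t` of a norm polynomial. -/
def dualTwist : Fˣ × Bˣ →* Fˣ × Bˣ :=
  MonoidHom.prod ((MonoidHom.fst _ _)⁻¹)
    ((Units.map (algebraMap F B).toMonoidHom).comp (MonoidHom.fst _ _)⁻¹ * MonoidHom.snd _ _)

variable {t} (hY : (frob F R 1).mapMatrix Y =
  (1 + z ^ (Fintype.card F - 1) • extRep ρ R t) * Y)

section Field

variable {Ω : Type*} [Field Ω] [Algebra F Ω] (θ : R →ₐ[F] Ω)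

include hY in
theorem frob_mapMatrix_point (N : ℕ) : (frob F Ω N).mapMatrix (θ.mapMatrix Y) =
    aeval (extRep ρ Ω t) (∏ i ∈ Finset.range N,
      (1 + C ((θ z ^ (Fintype.card F - 1)) ^ Fintype.card F ^ i) * X)) * θ.mapMatrix Y := by
  induction N with
  | zero =>
    ext i j
    simp [frob_apply]
  | succ N ih =>
    have h1 : (frob F Ω (N + 1)).mapMatrix (θ.mapMatrix Y) =
        (frob F Ω N).mapMatrix (θ.mapMatrix ((frob F R 1).mapMatrix Y)) := by
      ext i j
      simp [frob_apply, pow_succ', pow_mul]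
    have h2 : (frob F Ω N).mapMatrix (θ.mapMatrix (z ^ (Fintype.card F - 1) • extRep ρ R t)) =
        ((θ z ^ (Fintype.card F - 1)) ^ Fintype.card F ^ N) • extRep ρ Ω t := by
      rw [← mapMatrix_extRep ρ ((frob F Ω N).comp θ)]
      ext i j
      simp [frob_apply, mul_pow]
    rw [h1, hY, map_mul, map_mul, map_add, map_add, map_one, map_one, h2, ih, ← mul_assoc]
    congr 1
    rw [Finset.prod_range_succ, mul_comm (Finset.prod _ _), map_mul]
    simp [Algebra.smul_def]

variable {θ}

theorem IsGood.map_eq {x : Ω} {N : ℕ} {γ : Fˣ × Bˣ} (hx : IsGood t N γ x)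
    (hθ : θ z ^ (Fintype.card F - 1) = -x⁻¹) :
    algebraMap F Ω γ.1⁻¹ = ∏ i ∈ Finset.range N, (θ z ^ (Fintype.card F - 1)) ^ Fintype.card F ^ i ∧
    aeval (extRep ρ Ω t) (∏ i ∈ Finset.range N,
      (1 + C ((θ z ^ (Fintype.card F - 1)) ^ Fintype.card F ^ i) * X)) =
    extRep ρ Ω ((dualTwist γ).2 : B) := by
  obtain ⟨hx0, hxN, f, hf, hf0, hft⟩ := hx
  set q := Fintype.card F with hq
  set G : Polynomial Ω := ∏ i ∈ Finset.range N, (1 + C ((θ z ^ (q - 1)) ^ q ^ i) * X) with hG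
  have hc : algebraMap F Ω γ.1 = ∏ i ∈ Finset.range N, (-x ^ q ^ i) := by
    have := congrArg (eval 0) hf
    rw [eval_zero_map, hf0, eval_prod] at this
    simpa using this
  have hpow : ∀ i, (θ z ^ (q - 1)) ^ q ^ i = - (x ^ q ^ i)⁻¹ := fun i => by
    rw [hθ, hq, ← frob_apply, map_neg, map_inv₀, frob_apply]
  have hfG : f.map (algebraMap F Ω) = C (algebraMap F Ω γ.1) * G := by
    rw [hf, hG, hc, map_prod, ← Finset.prod_mul_distrib]
    refine Finset.prod_congr rfl fun i _ => ?_
    have : x ^ q ^ i ≠ 0 := pow_ne_zero _ hx0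
    rw [hpow, mul_add, mul_one, ← mul_assoc, ← C_mul, neg_mul_neg, mul_inv_cancel₀ this]
    simp [sub_eq_neg_add]
  refine ⟨?_, ?_⟩
  · rw [map_inv₀, hc, ← Finset.prod_inv_distrib]
    exact Finset.prod_congr rfl fun i _ => by rw [hpow, inv_neg]
  · have h3 := congrArg (aeval (extRep ρ Ω t)) hfG
    rw [aeval_map_algebraMap, aeval_algHom_apply, hft, map_mul, aeval_C] at h3
    have h4 : ((dualTwist γ).2 : B) = algebraMap F B ((γ.1 : F)⁻¹) * γ.2 := by
      simp [dualTwist]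
    rw [h4, map_mul, AlgHom.commutes, h3, ← mul_assoc,
      IsScalarTower.algebraMap_apply F Ω (Matrix n n Ω), ← map_mul, ← map_mul,
      inv_mul_cancel₀ γ.1.ne_zero, map_one, map_one, one_mul]

include hY in
theorem IsGood.isTwist {N : ℕ} {γ : Fˣ × Bˣ} {x : Ω} (hx : IsGood t N γ x)
    (hθ : θ z ^ (Fintype.card F - 1) = -x⁻¹) :
    IsTwist ρ z Y θ ((frob F Ω N).comp θ) (dualTwist γ) := by
  obtain ⟨h1, h2⟩ := hx.map_eq (ρ := ρ) hθ
  set q := Fintype.card F with hq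
  have hq1 : 1 + (q - 1) = q := Nat.add_sub_cancel' Fintype.card_pos
  refine ⟨?_, ?_⟩
  · have htel : ∀ N, (∏ i ∈ Finset.range N, (θ z ^ (q - 1)) ^ q ^ i) * θ z = θ z ^ q ^ N := by
      intro N
      induction N with
      | zero => simp
      | succ N ih =>
        rw [Finset.prod_range_succ, mul_right_comm, ih, ← pow_mul, ← pow_add, pow_succ']
        congr 1
        rw [← one_add_mul, hq1]
    rw [AlgHom.comp_apply, frob_apply, ← htel, Algebra.smul_def, ← h1]
    simp [dualTwist]
  · have h3 : (frob F Ω N).mapMatrix (θ.mapMatrix Y) = ((frob F Ω N).comp θ).mapMatrix Y := by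
      ext; simp
    rw [← h3, frob_mapMatrix_point hY, h2]

variable [IsDomain R] (hdet : Y.det ≠ 0)

include hY hdet in
theorem IsGood.det_ne_zero {N : ℕ} (hN : 0 < N) {γ : Fˣ × Bˣ} {x : Ω} (hx : IsGood t N γ x)
    (hθ : θ z ^ (Fintype.card F - 1) = -x⁻¹) : (θ.mapMatrix Y).det ≠ 0 := by
  have hq1 : Fintype.card F - 1 ≠ 0 := by
    have : 1 < Fintype.card F := Fintype.one_lt_card
    omega
  have h1 : Y.det ^ (Fintype.card F - 1) =
      (1 + z ^ (Fintype.card F - 1) • extRep ρ R t).det := by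
    have := congrArg Matrix.det hY
    rw [Matrix.det_mul, ← AlgHom.map_det, frob_apply, pow_one,
      ← pow_sub_one_mul Fintype.card_ne_zero] at this
    exact mul_right_cancel₀ hdet this
  have h2 : (θ.mapMatrix Y).det ^ (Fintype.card F - 1) =
      (aeval (extRep ρ Ω t) (1 + C (θ z ^ (Fintype.card F - 1)) * X)).det := by
    have h : aeval (extRep ρ Ω t) (1 + C (θ z ^ (Fintype.card F - 1)) * X) =
        1 + θ z ^ (Fintype.card F - 1) • extRep ρ Ω t := by
      simp [Algebra.smul_def]
    rw [← AlgHom.map_det, ← map_pow, h1, AlgHom.map_det, map_add, map_one, h]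
    congr 2
    rw [← mapMatrix_extRep ρ θ]
    ext i j
    simp
  obtain ⟨-, h3⟩ := hx.map_eq (ρ := ρ) hθ
  have h4 : IsUnit (extRep ρ Ω ((dualTwist γ).2 : B)) := (Units.isUnit _).map _
  rw [← h3] at h4
  obtain ⟨g, hg⟩ := Finset.dvd_prod_of_mem
    (fun i => (1 + C ((θ z ^ (Fintype.card F - 1)) ^ Fintype.card F ^ i) * X : Polynomial Ω))
    (Finset.mem_range.2 hN)
  rw [hg, map_mul, Matrix.isUnit_iff_isUnit_det, Matrix.det_mul, pow_zero, pow_one, ← h2] at h4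
  intro h0
  rw [h0, zero_pow hq1, zero_mul] at h4
  exact not_isUnit_zero h4

include hY hdet in
/-- Translating points by realized twists gives distinct solutions of the twisted Frobenius
equation. -/
theorem card_mul_ncard_good_le [Finite B] (hρ : Function.Injective ρ)
    (hsel : ∀ x : Ω, x ≠ 0 → ∃ θ : R →ₐ[F] Ω, θ z ^ (Fintype.card F - 1) = -x⁻¹)
    {N : ℕ} (hN : 0 < N) (γ : Fˣ × Bˣ)
    (hfin : {φ : R →ₐ[F] Ω | IsTwist ρ z Y φ ((frob F Ω N).comp φ) (dualTwist γ)}.Finite) :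
    Nat.card (twistGroup ρ z Y) * {x : Ω | IsGood t N γ x}.ncard ≤
      {φ : R →ₐ[F] Ω | IsTwist ρ z Y φ ((frob F Ω N).comp φ) (dualTwist γ)}.ncard := by
  choose θ hθ using fun x : {x : Ω | IsGood t N γ x} => hsel x x.2.1
  choose σ hσ using fun h : twistGroup ρ z Y => h.2
  rw [← Nat.card_coe_set_eq, ← Nat.card_coe_set_eq, ← Nat.card_prod]
  have := hfin.to_subtype
  refine Nat.card_le_card_of_injective (fun p : twistGroup ρ z Y × {x : Ω | IsGood t N γ x} =>
    (⟨(θ p.2).comp (σ p.1), ((p.2.2.isTwist hY (hθ p.2)).of_commute ((hσ p.1).comp _)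
      ((hσ p.1).comp ((frob F Ω N).comp (θ p.2))))⟩ :
      {φ : R →ₐ[F] Ω | IsTwist ρ z Y φ ((frob F Ω N).comp φ) (dualTwist γ)})) ?_
  have hz0 : ∀ x, θ x z ≠ 0 := fun x h => by
    have := hθ x
    have hq1 : Fintype.card F - 1 ≠ 0 := by
      have : 1 < Fintype.card F := Fintype.one_lt_card
      omega
    rw [h, zero_pow hq1, zero_eq_neg, inv_eq_zero] at this
    exact x.2.1 this
  rintro ⟨h, x⟩ ⟨h', x'⟩ heq
  have heq' : (θ x).comp (σ h) = (θ x').comp (σ h') := congrArg Subtype.val heq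
  have t1 := (hσ h).comp (θ x)
  have t2 := (hσ h').comp (θ x')
  rw [← heq'] at t2
  have hxx : x = x' := by
    have := t1.1.symm.trans t2.1
    have := congrArg (· ^ (Fintype.card F - 1)) this
    simp only [Algebra.smul_def, mul_pow, ← map_pow, FiniteField.pow_card_sub_one_eq_one _ (Units.ne_zero _),
      map_one, one_mul] at this
    rw [map_pow, map_pow, hθ, hθ, neg_inj, inv_inj] at this
    exact Subtype.ext this
  subst hxx
  have h1 := t1.1.symm.trans t2.1
  have h2 := t1.2.symm.trans t2.2
  have e1 : (h : Fˣ × Bˣ).1 = (h' : Fˣ × Bˣ).1 := by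
    have := smul_left_injective F (hz0 x) h1
    exact Units.ext this
  have e2 : (h : Fˣ × Bˣ).2 = (h' : Fˣ × Bˣ).2 := by
    have hu : IsUnit ((θ x).mapMatrix Y) :=
      (Matrix.isUnit_iff_isUnit_det _).2 (x.2.det_ne_zero hY hdet hN (hθ x)).isUnit
    exact Units.ext (extRep_injective ρ hρ Ω (hu.mul_right_cancel h2))
  exact Prod.ext (Subtype.ext (Prod.ext e1 e2)) rfl

end Field

end Points

/-- Homomorphisms to an algebraically closed field extend along integral extensions. -/
theorem nonempty_algHom_of_isIntegral (A R Ω : Type*) [CommRing A] [CommRing R] [Algebra A R]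
    [Algebra.IsIntegral A R] [FaithfulSMul A R] [Field Ω] [IsAlgClosed Ω] [Algebra A Ω] :
    Nonempty (R →ₐ[A] Ω) := by
  let P := RingHom.ker (algebraMap A Ω)
  have : P.IsPrime := RingHom.ker_isPrime _
  obtain ⟨Q, hQ, hQP⟩ := Ideal.exists_ideal_over_prime_of_isIntegral (S := R) P ⊥ (by
    rw [← RingHom.ker_eq_comap_bot, (RingHom.injective_iff_ker_eq_bot _).1
      (FaithfulSMul.algebraMap_injective A R)]
    exact bot_le)
  have : Q.LiesOver P := ⟨hQP.2.symm⟩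
  have : Q.IsPrime := hQP.1
  let f : A ⧸ P →+* Ω := Ideal.Quotient.lift P (algebraMap A Ω) fun a ha => ha
  let _ : Algebra (A ⧸ P) Ω := f.toAlgebra
  have : IsScalarTower A (A ⧸ P) Ω := IsScalarTower.of_algebraMap_eq fun a => rfl
  have : FaithfulSMul (A ⧸ P) Ω := (faithfulSMul_iff_algebraMap_injective _ _).2
    (RingHom.kerLift_injective (algebraMap A Ω))
  let g : R ⧸ Q →ₐ[A ⧸ P] Ω := IsAlgClosed.lift
  exact ⟨(g.restrictScalars A).comp (Ideal.Quotient.mkₐ A Q)⟩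

variable {F n B : Type*} [Field F] [Fintype F] [Fintype n] [DecidableEq n] [CommRing B] [Algebra F B]

section Ring

variable (T : Matrix n n F)

/-- The coordinate ring of the curve `Y⁽ᵠ⁾ = (1 + z ^ (q - 1) T) Y`. -/
noncomputable abbrev curveRing : Subalgebra F[X] (PowerSeries F) :=
  Algebra.adjoin F[X] (Set.range fun p : n × n => seriesMatrix T p.1 p.2)

/-- The tautological solution in the coordinate ring. -/
noncomputable def curveMatrix : Matrix n n (curveRing T) := fun i j =>
  ⟨seriesMatrix T i j, Algebra.subset_adjoin ⟨(i, j), rfl⟩⟩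

omit [Fintype F] in
theorem algebraMap_powerSeries_apply (p : F[X]) : algebraMap F[X] (PowerSeries F) p = p := by
  rw [PowerSeries.algebraMap_apply', Algebra.algebraMap_self, PowerSeries.map_id]
  rfl

omit [Fintype F] in
theorem algebraMap_powerSeries_injective : Function.Injective (algebraMap F[X] (PowerSeries F)) := by
  intro p p' h
  rw [algebraMap_powerSeries_apply, algebraMap_powerSeries_apply] at h
  exact Polynomial.coe_injective F h

theorem algebraMap_curveRing_injective : Function.Injective (algebraMap F[X] (curveRing T)) :=
  fun _ _ h => algebraMap_powerSeries_injective (congrArg Subtype.val h)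

instance : Module.Finite F[X] (curveRing T) := by
  refine finite_adjoin_of_pow_mem_span _ (q := Fintype.card F) Fintype.one_lt_card ?_
  rintro ⟨i, j⟩
  dsimp only
  rw [seriesMatrix_pow]
  refine Submodule.add_mem _ (Submodule.subset_span ⟨(i, j), rfl⟩) ?_
  rw [Finset.mul_sum]
  refine Submodule.sum_mem _ fun l _ => ?_
  have : PowerSeries.X ^ (Fintype.card F - 1) * (algebraMap F (PowerSeries F) (T i l) * seriesMatrix T l j)
      = (X ^ (Fintype.card F - 1) * C (T i l) : F[X]) • seriesMatrix T l j := by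
    rw [Algebra.smul_def, algebraMap_powerSeries_apply, ← mul_assoc]
    simp
    exact Or.inl (mul_comm _ _)
  rw [this]
  exact Submodule.smul_mem _ _ (Submodule.subset_span ⟨(l, j), rfl⟩)

theorem adjoin_curveMatrix : Algebra.adjoin F ({algebraMap F[X] (curveRing T) X} ∪
    Set.range fun p : n × n => curveMatrix T p.1 p.2) = ⊤ := by
  set A := Algebra.adjoin F ({algebraMap F[X] (curveRing T) X} ∪
    Set.range fun p : n × n => curveMatrix T p.1 p.2) with hA
  rw [eq_top_iff]
  rintro ⟨w, hw⟩ -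
  induction hw using Algebra.adjoin_induction with
  | mem w hw =>
    obtain ⟨p, rfl⟩ := hw
    exact Algebra.subset_adjoin (Or.inr ⟨p, rfl⟩)
  | algebraMap p =>
    have : aeval (algebraMap F[X] (curveRing T) X) p ∈ A := by
      exact Algebra.adjoin_mono Set.subset_union_left
        (aeval_mem_adjoin_singleton F _)
    rw [aeval_algebraMap_apply, aeval_X_left_apply] at this
    exact this
  | add v w hv hw h1 h2 => exact A.add_mem h1 h2
  | mul v w hv hw h1 h2 => exact A.mul_mem h1 h2

theorem frob_curveMatrix (ρ : B →ₐ[F] Matrix n n F) (t : B) :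
    (frob F (curveRing (ρ t)) 1).mapMatrix (curveMatrix (ρ t)) =
      (1 + (algebraMap F[X] (curveRing (ρ t)) X) ^ (Fintype.card F - 1) •
        extRep ρ (curveRing (ρ t)) t) * curveMatrix (ρ t) := by
  refine Matrix.ext fun i j => Subtype.ext ?_
  rw [add_mul, one_mul, Matrix.add_apply, Matrix.smul_mul, Matrix.smul_apply, Matrix.mul_apply]
  simp only [AlgHom.mapMatrix_apply, Matrix.map_apply, frob_apply, pow_one]
  push_cast
  rw [smul_eq_mul]
  push_cast
  have h1 : ∀ i j, ((curveMatrix (ρ t) i j : curveRing (ρ t)) : PowerSeries F) =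
    seriesMatrix (ρ t) i j := fun _ _ => rfl
  have h2 : ∀ l, ((extRep ρ (curveRing (ρ t)) t i l : curveRing (ρ t)) : PowerSeries F) =
    algebraMap F _ (ρ t i l) := fun _ => rfl
  have h3 : algebraMap F[X] (PowerSeries F) X = PowerSeries.X := by
    rw [algebraMap_powerSeries_apply, Polynomial.coe_X]
  rw [h3]
  simp only [h1, h2]
  exact seriesMatrix_pow (ρ t) i j

theorem det_curveMatrix_ne_zero : (curveMatrix T).det ≠ 0 := by
  intro h
  apply det_seriesMatrix_ne_zero T
  have := congrArg (curveRing T).val h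
  rwa [AlgHom.map_det, map_zero] at this

end Ring

/-- **Equidistribution up to a subgroup** for the values at `0` and `t` of the norm polynomials of
the points fixed by an even power of Frobenius. -/
theorem exists_subgroup_ncard_good_le [Finite B] (ρ : B →ₐ[F] Matrix n n F)
    (hρ : Function.Injective ρ) (t : B) (Ω : Type*) [Field Ω] [IsAlgClosed Ω] [Algebra F Ω] :
    ∃ (H : Subgroup (Fˣ × Bˣ)) (C k₀ : ℕ), ∀ k ≥ k₀, ∀ γ : Fˣ × Bˣ,
      (γ ∈ H → Nat.card H * {x : Ω | IsGood t (2 * k) γ x}.ncard ≤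
        Fintype.card F ^ (2 * k) + C * Fintype.card F ^ k) ∧
      (γ ∉ H → {x : Ω | IsGood t (2 * k) γ x}.ncard ≤ C) := by
  classical
  set R := curveRing (ρ t) with hR
  set Y := curveMatrix (ρ t) with hYdef
  set z := algebraMap F[X] R X with hz
  have hY := frob_curveMatrix ρ t
  have hdet := det_curveMatrix_ne_zero (ρ t)
  have hgen := adjoin_curveMatrix (ρ t)
  have hfaith : FaithfulSMul F[X] R :=
    (faithfulSMul_iff_algebraMap_injective _ _).2 (algebraMap_curveRing_injective (ρ t))
  have htf : IsTorsionFree F[X] R :=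
    isTorsionFree_iff_algebraMap_injective.2 (algebraMap_curveRing_injective (ρ t))
  have : Module.Free F[X] R := Module.free_of_finite_type_torsion_free'
  let b := Module.Free.chooseBasis F[X] R
  have hq1 : 0 < Fintype.card F - 1 := by
    have : 1 < Fintype.card F := Fintype.one_lt_card
    omega
  have hsel : ∀ x : Ω, x ≠ 0 → ∃ θ : R →ₐ[F] Ω, θ z ^ (Fintype.card F - 1) = -x⁻¹ := by
    intro x _
    obtain ⟨z₁, hz₁⟩ := IsAlgClosed.exists_pow_nat_eq (-x⁻¹) hq1
    let _ : Algebra F[X] Ω := (aeval z₁).toAlgebra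
    have : IsScalarTower F F[X] Ω := IsScalarTower.of_algebraMap_eq fun c => by
      rw [RingHom.algebraMap_toAlgebra]
      simp
    obtain ⟨θ⟩ := nonempty_algHom_of_isIntegral F[X] R Ω
    refine ⟨θ.restrictScalars F, ?_⟩
    rw [← hz₁, AlgHom.restrictScalars_apply, hz, AlgHom.commutes, RingHom.algebraMap_toAlgebra]
    simp
  have hpt : ∀ γ : Fˣ × Bˣ, ∃ C k₀ : ℕ, ∀ k ≥ k₀,
      (dualTwist γ ∈ twistGroup ρ z Y → Nat.card (twistGroup ρ z Y) * {x : Ω | IsGood t (2 * k) γ x}.ncard ≤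
        Fintype.card F ^ (2 * k) + C * Fintype.card F ^ k) ∧
      (dualTwist γ ∉ twistGroup ρ z Y → {x : Ω | IsGood t (2 * k) γ x}.ncard ≤ C) := by
    intro γ
    by_cases hγ : dualTwist γ ∈ twistGroup ρ z Y
    · obtain ⟨σ, hσ⟩ := id hγ
      set c : F := ((dualTwist γ).1 : F)
      obtain ⟨C, k₀, h⟩ := exists_ncard_fixed_le b (curveRing (ρ t)).val Subtype.val_injective σ
        (compRingHom (C c * X)) (fun p => by
          rw [coe_compRingHom_apply]
          refine natDegree_comp_le.trans ?_
          exact (Nat.mul_le_mul_left _ ((natDegree_C_mul_le _ _).trans natDegree_X_le)).trans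
            (mul_one _).le) (fun p => by
          have h1 : (σ : R →ₐ[F] R).comp (aeval z) = aeval (c • z) :=
            Polynomial.algHom_ext (by simpa using hσ.1)
          have h2 : ∀ p : F[X], algebraMap F[X] R p = aeval z p := fun p => by
            rw [hz, aeval_algebraMap_apply, aeval_X_left_apply]
          rw [h2, h2, coe_compRingHom_apply, aeval_comp, ← AlgHom.comp_apply, h1]
          simp [Algebra.smul_def]) Ω
      refine ⟨C, k₀ + 1, fun k hk => ⟨fun _ => ?_, fun h => absurd hγ h⟩⟩
      obtain ⟨h1, h2⟩ := h k (by omega)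
      have hsub : {φ : R →ₐ[F] Ω | IsTwist ρ z Y φ ((frob F Ω (2 * k)).comp φ) (dualTwist γ)} ⊆
          {θ : R →ₐ[F] Ω | ∀ w, θ w ^ Fintype.card F ^ (2 * k) = θ (σ w)} := fun φ hφ w => by
        rw [← frob_apply]
        exact DFunLike.congr_fun (hφ.unique hgen (hσ.comp φ)) w
      exact (card_mul_ncard_good_le hY hdet hρ hsel (by omega) γ (h1.subset hsub)).trans
        ((Set.ncard_le_ncard hsub h1).trans h2)
    · obtain ⟨w, hw, h⟩ := exists_ne_zero_of_not_mem_twistGroup hgen hγ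
      obtain ⟨h1, h2⟩ := card_zeros_le (Ω := Ω) b hw
      refine ⟨(Algebra.norm F[X] w).natDegree, 1, fun k hk => ⟨fun h => absurd h hγ, fun _ => ?_⟩⟩
      have hsub : {φ : R →ₐ[F] Ω | IsTwist ρ z Y φ ((frob F Ω (2 * k)).comp φ) (dualTwist γ)} ⊆
          {θ : R →ₐ[F] Ω | θ w = 0} := fun φ hφ => h _ _ hφ
      have h3 := card_mul_ncard_good_le hY hdet hρ hsel (N := 2 * k) (by omega) γ (h1.subset hsub)
      have h4 : 0 < Nat.card (twistGroup ρ z Y) := Nat.card_pos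
      exact (Nat.le_mul_of_pos_left _ h4).trans (h3.trans ((Set.ncard_le_ncard hsub h1).trans h2))
  have hdual : Function.Involutive (dualTwist (F := F) (B := B)) := by
    rintro ⟨c, b⟩
    ext <;> simp [dualTwist]
  have hcard : Nat.card ((twistGroup ρ z Y).comap dualTwist) = Nat.card (twistGroup ρ z Y) := by
    rw [Nat.card_congr (((twistGroup ρ z Y).comap dualTwist).equivMapOfInjective dualTwist
      hdual.injective).toEquiv, Subgroup.map_comap_eq_self_of_surjective hdual.surjective]
  choose C k₀ h using hpt
  have := Fintype.ofFinite (Fˣ × Bˣ)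
  refine ⟨(twistGroup ρ z Y).comap dualTwist, ∑ γ, C γ, ∑ γ, k₀ γ, fun k hk γ => ?_⟩
  have hC : C γ ≤ ∑ γ, C γ := Finset.single_le_sum (fun _ _ => Nat.zero_le _) (Finset.mem_univ γ)
  have hk₀ : k₀ γ ≤ ∑ γ, k₀ γ := Finset.single_le_sum (fun _ _ => Nat.zero_le _) (Finset.mem_univ γ)
  obtain ⟨h1, h2⟩ := h γ k (hk₀.trans hk)
  rw [hcard]
  exact ⟨fun hγ => (h1 hγ).trans (by gcongr), fun hγ => (h2 hγ).trans hC⟩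

section Points

open Function

variable {F Ω : Type*} [Field F] [Fintype F] [Field Ω] [Algebra F Ω]

theorem exists_algebraMap_eq_of_pow_card_eq {y : Ω} (hy : y ^ Fintype.card F = y) :
    ∃ c : F, algebraMap F Ω c = y := by
  have h := FiniteField.roots_X_pow_card_sub_X F
  have hs : (X ^ Fintype.card F - X : F[X]) = ∏ c : F, (X - C c) := by
    have hm : (X ^ Fintype.card F - X : F[X]).Monic :=
      monic_X_pow_sub (by rw [degree_X]; exact_mod_cast Fintype.one_lt_card)
    have := (prod_multiset_X_sub_C_of_monic_of_roots_card_eq hm (by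
      rw [h, FiniteField.X_pow_card_sub_X_natDegree_eq F Fintype.one_lt_card]; rfl)).symm
    rwa [h] at this
  have h2 := congrArg (aeval y) hs
  rw [map_sub, map_pow, aeval_X, hy, sub_self, map_prod, eq_comm, Finset.prod_eq_zero_iff] at h2
  obtain ⟨c, -, hc⟩ := h2
  rw [map_sub, aeval_X, aeval_C, sub_eq_zero] at hc
  exact ⟨c, hc.symm⟩

omit [Field F] [Algebra F Ω] in
theorem pow_card_pow_eq_iff {x : Ω} {N : ℕ} : x ^ Fintype.card F ^ N = x ↔
    IsPeriodicPt (fun y : Ω => y ^ Fintype.card F) N x := by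
  rw [IsPeriodicPt, IsFixedPt, pow_iterate]

theorem exists_map_eq_prod {x : Ω} {N : ℕ} (hx : x ^ Fintype.card F ^ N = x) :
    ∃ f : F[X], f.map (algebraMap F Ω) = ∏ i ∈ Finset.range N, (X - C (x ^ Fintype.card F ^ i)) := by
  rw [← mem_lifts, lifts_iff_coeff_lifts]
  intro j
  refine exists_algebraMap_eq_of_pow_card_eq ?_
  have h1 : (∏ i ∈ Finset.range N, (X - C (x ^ Fintype.card F ^ i))).map (frob F Ω 1).toRingHom =
      ∏ i ∈ Finset.range N, (X - C (x ^ Fintype.card F ^ i)) := by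
    rw [Polynomial.map_prod]
    have h2 : ∀ i, (X - C (x ^ Fintype.card F ^ i)).map (frob F Ω 1).toRingHom =
        X - C (x ^ Fintype.card F ^ (i + 1)) := fun i => by
      rw [Polynomial.map_sub, map_X, map_C]
      change X - C (frob F Ω 1 _) = _
      rw [frob_apply, ← pow_mul, ← pow_add]
    simp only [h2]
    rcases N with _ | N
    · rfl
    · rw [Finset.prod_range_succ, hx, Finset.prod_range_succ']
      simp
  conv_rhs => rw [← h1, coeff_map]
  change _ = frob F Ω 1 _
  rw [frob_apply, pow_one]

theorem aeval_pow_card_pow (f : F[X]) (x : Ω) (i : ℕ) :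
    aeval (x ^ Fintype.card F ^ i) f = aeval x f ^ Fintype.card F ^ i := by
  rw [← frob_apply, ← frob_apply, aeval_algHom_apply]

theorem isIntegral_of_pow_card_pow_eq {x : Ω} {N : ℕ} (hN : 0 < N)
    (hx : x ^ Fintype.card F ^ N = x) : IsIntegral F x := by
  refine ⟨X ^ Fintype.card F ^ N - X, monic_X_pow_sub ?_, by simp [hx]⟩
  rw [degree_X]
  exact_mod_cast Nat.one_lt_pow hN.ne' Fintype.one_lt_card

theorem map_minpoly_eq_prod {x : Ω} {N : ℕ} (hN : 0 < N) (hx : x ^ Fintype.card F ^ N = x) :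
    (minpoly F x).map (algebraMap F Ω) =
      ∏ i ∈ Finset.range (minimalPeriod (fun y : Ω => y ^ Fintype.card F) x),
        (X - C (x ^ Fintype.card F ^ i)) := by
  set d := minimalPeriod (fun y : Ω => y ^ Fintype.card F) x with hd
  have hd0 : 0 < d := IsPeriodicPt.minimalPeriod_pos hN (pow_card_pow_eq_iff.1 hx)
  have hxd : x ^ Fintype.card F ^ d = x :=
    pow_card_pow_eq_iff.2 (isPeriodicPt_minimalPeriod _ _)
  obtain ⟨f, hf⟩ := exists_map_eq_prod hxd
  have hxi := isIntegral_of_pow_card_pow_eq hN hx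
  refine Polynomial.eq_of_monic_of_associated ((minpoly.monic hxi).map _)
    (monic_prod_of_monic _ _ fun i _ => monic_X_sub_C _) (associated_of_dvd_dvd ?_ ?_)
  · rw [← hf]
    refine Polynomial.map_dvd _ (minpoly.dvd _ _ ?_)
    rw [aeval_def, ← eval_map, hf, eval_prod]
    exact Finset.prod_eq_zero (Finset.mem_range.2 hd0) (by simp)
  · refine Finset.prod_dvd_of_coprime ?_ ?_
    · intro i hi j hj hij
      refine isCoprime_X_sub_C_of_isUnit_sub (IsUnit.mk0 _ (sub_ne_zero.2 fun h => hij ?_))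
      have := iterate_injOn_Iio_minimalPeriod (f := fun y : Ω => y ^ Fintype.card F) (x := x)
        (Set.mem_Iio.2 (Finset.mem_range.1 hi)) (Set.mem_Iio.2 (Finset.mem_range.1 hj))
      simp only [pow_iterate] at this
      exact this h
    · intro i _
      rw [dvd_iff_isRoot, IsRoot, eval_map, ← aeval_def, aeval_pow_card_pow, minpoly.aeval,
        zero_pow (pow_ne_zero _ Fintype.card_ne_zero)]

theorem natDegree_minpoly_eq_minimalPeriod {x : Ω} {N : ℕ} (hN : 0 < N)
    (hx : x ^ Fintype.card F ^ N = x) :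
    (minpoly F x).natDegree = minimalPeriod (fun y : Ω => y ^ Fintype.card F) x := by
  rw [← natDegree_map (algebraMap F Ω), map_minpoly_eq_prod hN hx,
    natDegree_prod_of_monic _ _ fun i _ => monic_X_sub_C _]
  simp only [natDegree_X_sub_C, Finset.sum_const, Finset.card_range, smul_eq_mul, mul_one]

theorem pow_card_pow_eq_iff_natDegree_dvd {x : Ω} (hx : IsIntegral F x) {k : ℕ} :
    x ^ Fintype.card F ^ k = x ↔ (minpoly F x).natDegree ∣ k := by
  rcases Nat.eq_zero_or_pos k with rfl | hk
  · simp
  have h1 : x ^ Fintype.card F ^ (minpoly F x).natDegree = x := by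
    have hirr := minpoly.irreducible hx
    have := Fact.mk hirr
    have := (minpoly.monic hx).finite_adjoinRoot
    have : Finite (AdjoinRoot (minpoly F x)) := Module.finite_of_finite F
    have := Fintype.ofFinite (AdjoinRoot (minpoly F x))
    have hc : Fintype.card (AdjoinRoot (minpoly F x)) =
        Fintype.card F ^ (minpoly F x).natDegree := by
      rw [Module.card_eq_pow_finrank (K := F), (AdjoinRoot.powerBasis hirr.ne_zero).finrank,
        AdjoinRoot.powerBasis_dim]
    have h2 := FiniteField.pow_card (AdjoinRoot.root (minpoly F x))
    rw [hc] at h2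
    have hroot : eval₂ (Algebra.ofId F Ω : F →+* Ω) x (minpoly F x) = 0 := minpoly.aeval F x
    have h3 := congrArg (AdjoinRoot.liftAlgHom (minpoly F x) (Algebra.ofId F Ω) x hroot) h2
    rwa [map_pow, AdjoinRoot.liftAlgHom_root] at h3
  constructor
  · intro h
    rw [natDegree_minpoly_eq_minimalPeriod hk h]
    exact (pow_card_pow_eq_iff.1 h).minimalPeriod_dvd
  · intro h
    rw [natDegree_minpoly_eq_minimalPeriod (minpoly.natDegree_pos hx) h1] at h
    exact pow_card_pow_eq_iff.2 (isPeriodicPt_iff_minimalPeriod_dvd.2 h)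

variable (F)

/-- The characteristic polynomial of a point fixed by the `N`-th power of Frobenius. -/
noncomputable def normPoly (N : ℕ) (x : Ω) : F[X] := minpoly F x ^ (N / (minpoly F x).natDegree)

variable {F}

theorem map_normPoly {x : Ω} {N : ℕ} (hN : 0 < N) (hx : x ^ Fintype.card F ^ N = x) :
    (normPoly F N x).map (algebraMap F Ω) =
      ∏ i ∈ Finset.range N, (X - C (x ^ Fintype.card F ^ i)) := by
  have hper := pow_card_pow_eq_iff.1 hx
  rw [normPoly, Polynomial.map_pow, map_minpoly_eq_prod hN hx,
    natDegree_minpoly_eq_minimalPeriod hN hx]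
  obtain ⟨j, rfl⟩ := hper.minimalPeriod_dvd
  rw [Nat.mul_div_cancel_left _ (hper.minimalPeriod_pos hN)]
  clear hper hx hN
  set d := minimalPeriod (fun y : Ω => y ^ Fintype.card F) x with hd
  have hxd : x ^ Fintype.card F ^ d = x :=
    pow_card_pow_eq_iff.2 (isPeriodicPt_minimalPeriod _ _)
  have hdj : ∀ j, x ^ Fintype.card F ^ (d * j) = x := fun j =>
    pow_card_pow_eq_iff.2 ((isPeriodicPt_minimalPeriod _ _).mul_const j)
  induction j with
  | zero => simp
  | succ j ih =>
    rw [pow_succ, ih, mul_add_one, Finset.prod_range_add]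
    simp only [pow_add, pow_mul x, hdj]

theorem normPoly_monic {x : Ω} {N : ℕ} (hN : 0 < N) (hx : x ^ Fintype.card F ^ N = x) :
    (normPoly F N x).Monic :=
  (minpoly.monic (isIntegral_of_pow_card_pow_eq hN hx)).pow _

theorem natDegree_normPoly {x : Ω} {N : ℕ} (hN : 0 < N) (hx : x ^ Fintype.card F ^ N = x) :
    (normPoly F N x).natDegree = N := by
  rw [← natDegree_map (algebraMap F Ω), map_normPoly hN hx,
    natDegree_prod_of_monic _ _ fun i _ => monic_X_sub_C _]
  simp only [natDegree_X_sub_C, Finset.sum_const, Finset.card_range, smul_eq_mul, mul_one]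

end Points

section Counting

variable (F Ω : Type*) [Field F] [Fintype F] [Field Ω] [Algebra F Ω]

open Classical in
/-- The points fixed by the `N`-th power of Frobenius. -/
noncomputable def fixedPts (N : ℕ) : Finset Ω :=
  (X ^ Fintype.card F ^ N - X : Polynomial Ω).roots.toFinset

variable {F Ω}

omit [Field F] [Algebra F Ω] in
theorem mem_fixedPts {N : ℕ} (hN : 0 < N) {x : Ω} [Field F] :
    x ∈ fixedPts F Ω N ↔ x ^ Fintype.card F ^ N = x := by
  have h : (X ^ Fintype.card F ^ N - X : Polynomial Ω) ≠ 0 :=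
    FiniteField.X_pow_card_pow_sub_X_ne_zero Ω hN.ne' Fintype.one_lt_card
  simp [fixedPts, h, sub_eq_zero]

open Classical in
theorem card_fixedPts [IsAlgClosed Ω] {N : ℕ} (hN : 0 < N) :
    (fixedPts F Ω N).card = Fintype.card F ^ N := by
  have h : (X ^ Fintype.card F ^ N - X : Polynomial Ω).Separable := by
    obtain ⟨p, hp⟩ := CharP.exists F
    have := charP_of_injective_algebraMap (algebraMap F Ω).injective p
    exact galois_poly_separable p _ (dvd_pow ((CharP.cast_eq_zero_iff F p _).1
      (FiniteField.cast_card_eq_zero F)) hN.ne')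
  rw [fixedPts, Multiset.toFinset_card_of_nodup (nodup_roots h),
    (IsAlgClosed.splits _).natDegree_eq_card_roots.symm,
    FiniteField.X_pow_card_pow_sub_X_natDegree_eq Ω hN.ne' Fintype.one_lt_card]

theorem aeval_normPoly {x : Ω} {N : ℕ} (hN : 0 < N) (hx : x ^ Fintype.card F ^ N = x) :
    aeval x (normPoly F N x) = 0 := by
  have hxi := isIntegral_of_pow_card_pow_eq hN hx
  rw [normPoly, map_pow, minpoly.aeval, zero_pow]
  exact (Nat.div_pos (Nat.le_of_dvd hN ((pow_card_pow_eq_iff_natDegree_dvd hxi).1 hx))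
    (minpoly.natDegree_pos hxi)).ne'

open Classical in
theorem card_filter_normPoly_dvd {f : F[X]} (hf : f ≠ 0) (x : Ω) :
    ((Finset.Icc 1 f.natDegree).filter fun k => x ∈ fixedPts F Ω k ∧ normPoly F k x ∣ f).card =
      (f.map (algebraMap F Ω)).rootMultiplicity x := by
  by_cases hx : aeval x f = 0
  swap
  · rw [rootMultiplicity_eq_zero (by rwa [IsRoot, eval_map, ← aeval_def]), Finset.card_eq_zero,
      Finset.filter_eq_empty_iff]
    rintro k hk ⟨h1, g, rfl⟩
    have hk : 0 < k := (Finset.mem_Icc.1 hk).1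
    rw [mem_fixedPts hk] at h1
    rw [map_mul, aeval_normPoly hk h1, zero_mul] at hx
    exact hx rfl
  have hxi : IsIntegral F x := (IsAlgebraic.isIntegral ⟨f, hf, hx⟩)
  have hirr := minpoly.irreducible hxi
  set P := minpoly F x with hP
  have hd : 0 < P.natDegree := minpoly.natDegree_pos hxi
  obtain ⟨g, hfg, hg⟩ := (FiniteMultiplicity.of_not_isUnit hirr.not_isUnit hf :
    FiniteMultiplicity P f).exists_eq_pow_mul_and_not_dvd
  set e := multiplicity P f
  have hmul : (f.map (algebraMap F Ω)).rootMultiplicity x = e := by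
    have hne : f.map (algebraMap F Ω) ≠ 0 := map_ne_zero hf
    have h1 : (P.map (algebraMap F Ω)).rootMultiplicity x = 1 := by
      refine le_antisymm (rootMultiplicity_le_one_of_separable (PerfectField.separable_of_irreducible hirr).map x) ?_
      exact (rootMultiplicity_pos (map_ne_zero hirr.ne_zero)).2 (by
        rw [IsRoot, eval_map, ← aeval_def, minpoly.aeval])
    have h2 : (g.map (algebraMap F Ω)).rootMultiplicity x = 0 :=
      rootMultiplicity_eq_zero (by
        rw [IsRoot, eval_map, ← aeval_def]
        exact fun h => hg (minpoly.dvd _ _ h))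
    rw [hfg, Polynomial.map_mul, Polynomial.map_pow] at hne ⊢
    rw [rootMultiplicity_mul hne, ← count_roots, roots_pow, Multiset.count_nsmul, count_roots, h1, h2,
      mul_one, add_zero]
  have hset : ((Finset.Icc 1 f.natDegree).filter fun k =>
      x ∈ fixedPts F Ω k ∧ normPoly F k x ∣ f) = (Finset.Icc 1 e).image (P.natDegree * ·) := by
    have hdvd : ∀ j, P ^ j ∣ f ↔ j ≤ e := fun j =>
      (FiniteMultiplicity.of_not_isUnit hirr.not_isUnit hf).pow_dvd_iff_le_multiplicity
    ext k
    simp only [Finset.mem_filter, Finset.mem_Icc, Finset.mem_image]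
    constructor
    · rintro ⟨⟨hk, -⟩, h1, h2⟩
      rw [mem_fixedPts hk, pow_card_pow_eq_iff_natDegree_dvd hxi] at h1
      obtain ⟨j, rfl⟩ := h1
      rw [normPoly, Nat.mul_div_cancel_left _ hd, hdvd] at h2
      exact ⟨j, ⟨Nat.pos_of_mul_pos_left hk, h2⟩, rfl⟩
    · rintro ⟨j, ⟨hj, hje⟩, rfl⟩
      have hk : 0 < P.natDegree * j := Nat.mul_pos hd hj
      refine ⟨⟨hk, ?_⟩, ?_, ?_⟩
      · have := natDegree_le_of_dvd ((hdvd j).2 hje) hf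
        rwa [natDegree_pow, mul_comm] at this
      · rw [mem_fixedPts hk, pow_card_pow_eq_iff_natDegree_dvd hxi]
        exact dvd_mul_right _ _
      · rw [normPoly, Nat.mul_div_cancel_left _ hd, hdvd]
        exact hje
  rw [hset, hmul, Finset.card_image_of_injective _ (mul_right_injective₀ hd.ne')]
  simp

open Classical in
theorem sum_card_filter_normPoly_dvd [IsAlgClosed Ω] {f : F[X]} (hf : f ≠ 0) :
    ∑ k ∈ Finset.Icc 1 f.natDegree, ((fixedPts F Ω k).filter fun x => normPoly F k x ∣ f).card =
      f.natDegree := by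
  have h1 : ∀ k ∈ Finset.Icc 1 f.natDegree, (fixedPts F Ω k).filter (fun x => normPoly F k x ∣ f) =
      ((f.map (algebraMap F Ω)).roots.toFinset).filter
        fun x => x ∈ fixedPts F Ω k ∧ normPoly F k x ∣ f := by
    intro k hk
    have hk0 : 0 < k := (Finset.mem_Icc.1 hk).1
    ext x
    simp only [Finset.mem_filter, Multiset.mem_toFinset, mem_roots (map_ne_zero hf), IsRoot,
      eval_map, ← aeval_def, iff_and_self]
    rintro ⟨h1, g, rfl⟩
    rw [mem_fixedPts hk0] at h1
    rw [map_mul, aeval_normPoly hk0 h1, zero_mul]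
  rw [Finset.sum_congr rfl fun k hk => congrArg Finset.card (h1 k hk)]
  have h2 := Finset.sum_card_bipartiteAbove_eq_sum_card_bipartiteBelow
    (s := Finset.Icc 1 f.natDegree) (t := (f.map (algebraMap F Ω)).roots.toFinset)
    (fun k x => x ∈ fixedPts F Ω k ∧ normPoly F k x ∣ f)
  simp only [Finset.bipartiteAbove, Finset.bipartiteBelow] at h2
  rw [h2]
  simp only [card_filter_normPoly_dvd hf, ← count_roots]
  rw [Multiset.toFinset_sum_count_eq, ← (IsAlgClosed.splits _).natDegree_eq_card_roots, natDegree_map]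

end Counting

section LFunction

variable (F Ω : Type*) [Field F] [Fintype F] [Field Ω] [Algebra F Ω]

theorem finite_monic_natDegree_eq (n : ℕ) : {f : F[X] | f.Monic ∧ f.natDegree = n}.Finite := by
  have : Finite (degreeLT F n) := Finite.of_equiv _ (degreeLTEquiv F n).toEquiv.symm
  exact Set.finite_coe_iff.1 (Finite.of_equiv _ (monicEquivDegreeLT n).symm)

/-- The monic polynomials of degree `n`. -/
noncomputable def monicDeg (n : ℕ) : Finset F[X] := (finite_monic_natDegree_eq F n).toFinset

variable {F}

theorem mem_monicDeg {n : ℕ} {f : F[X]} : f ∈ monicDeg F n ↔ f.Monic ∧ f.natDegree = n := by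
  simp [monicDeg]

theorem monicDeg_zero : monicDeg F 0 = {1} := by
  ext f
  rw [mem_monicDeg, Finset.mem_singleton]
  constructor
  · rintro ⟨h1, h2⟩
    exact h1.natDegree_eq_zero.1 h2
  · rintro rfl
    exact ⟨monic_one, natDegree_one⟩

/-- The power sums of the `L`-function of `c`. -/
noncomputable def charPsi (c : F[X] →* ℂ) (N : ℕ) : ℂ := ∑ x ∈ fixedPts F Ω N, c (normPoly F N x)

theorem natCast_mul_sum_monicDeg [IsAlgClosed Ω] (c : F[X] →* ℂ) (n : ℕ) :
    n * ∑ f ∈ monicDeg F n, c f =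
      ∑ k ∈ Finset.Icc 1 n, charPsi Ω c k * ∑ f ∈ monicDeg F (n - k), c f := by
  classical
  have h1 : ∀ k ∈ Finset.Icc 1 n, charPsi Ω c k * ∑ f ∈ monicDeg F (n - k), c f =
      ∑ f ∈ monicDeg F n, ∑ x ∈ (fixedPts F Ω k).filter fun x => normPoly F k x ∣ f, c f := by
    intro k hk
    obtain ⟨hk, hkn⟩ := Finset.mem_Icc.1 hk
    simp only [Finset.sum_filter]
    rw [Finset.sum_comm, charPsi, Finset.sum_mul]
    refine Finset.sum_congr rfl fun x hx => ?_
    rw [mem_fixedPts hk] at hx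
    have hm := normPoly_monic hk hx
    rw [← Finset.sum_filter, Finset.mul_sum]
    refine Finset.sum_bij (fun g _ => normPoly F k x * g) ?_ ?_ ?_ ?_
    · intro g hg
      rw [mem_monicDeg] at hg
      rw [Finset.mem_filter, mem_monicDeg, hm.natDegree_mul hg.1, natDegree_normPoly hk hx, hg.2]
      exact ⟨⟨hm.mul hg.1, by omega⟩, dvd_mul_right _ _⟩
    · intro g _ g' _ h
      exact mul_left_cancel₀ hm.ne_zero h
    · intro f hf
      rw [Finset.mem_filter, mem_monicDeg] at hf
      obtain ⟨⟨hf1, hf2⟩, g, rfl⟩ := hf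
      have hg := hm.of_mul_monic_left hf1
      rw [hm.natDegree_mul hg, natDegree_normPoly hk hx] at hf2
      exact ⟨g, mem_monicDeg.2 ⟨hg, by omega⟩, rfl⟩
    · intro g _
      rw [map_mul]
  rw [Finset.sum_congr rfl h1, Finset.sum_comm, Finset.mul_sum]
  refine Finset.sum_congr rfl fun f hf => ?_
  rw [mem_monicDeg] at hf
  simp only [Finset.sum_const, nsmul_eq_mul]
  rw [← Finset.sum_mul, ← Nat.cast_sum]
  have := sum_card_filter_normPoly_dvd (Ω := Ω) hf.1.ne_zero
  rw [hf.2] at this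
  rw [this]

theorem charPsi_eq_neg_sum_pow [IsAlgClosed Ω] (c : F[X] →* ℂ) {σ : Type*} [Fintype σ] (α : σ → ℂ)
    (h : ∀ n, ∑ f ∈ monicDeg F n, c f = (-1) ^ n * MvPolynomial.aeval α (MvPolynomial.esymm σ ℂ n))
    {N : ℕ} (hN : 0 < N) : charPsi Ω c N = - ∑ i, α i ^ N := by
  classical
  induction N using Nat.strong_induction_on with
  | _ N ih =>
    have h1 := natCast_mul_sum_monicDeg Ω c N
    have h2 := congrArg (MvPolynomial.aeval α) (MvPolynomial.mul_esymm_eq_sum σ ℂ N)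
    have hps : ∀ k, MvPolynomial.aeval α (MvPolynomial.psum σ ℂ k) = ∑ i, α i ^ k := fun k => by
      simp [MvPolynomial.psum]
    have h3 : (N : ℂ) * ∑ f ∈ monicDeg F N, c f =
        - ∑ k ∈ Finset.Icc 1 N, (∑ i, α i ^ k) * ∑ f ∈ monicDeg F (N - k), c f := by
      rw [h N, mul_left_comm]
      simp only [map_mul, map_natCast] at h2
      rw [h2, map_pow, map_neg, map_one, map_sum, ← mul_assoc, ← pow_add, ← Finset.sum_neg_distrib,
        (show N + (N + 1) = 2 * N + 1 by ring), pow_succ, pow_mul, neg_one_sq, one_pow, one_mul,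
        neg_one_mul, ← Finset.sum_neg_distrib]
      refine Finset.sum_bij' (fun a _ => a.2) (fun k _ => (N - k, k)) ?_ ?_ ?_ ?_ ?_
      · rintro ⟨a, b⟩ hab
        simp only [Finset.mem_filter, Finset.HasAntidiagonal.mem_antidiagonal, Finset.mem_Icc] at hab ⊢
        omega
      · intro k hk
        simp only [Finset.mem_filter, Finset.HasAntidiagonal.mem_antidiagonal, Finset.mem_Icc] at hk ⊢
        omega
      · rintro ⟨a, b⟩ hab
        simp only [Finset.mem_filter, Finset.HasAntidiagonal.mem_antidiagonal] at hab
        exact Prod.ext (by simp; omega) rfl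
      · intro k hk
        rfl
      · rintro ⟨a, b⟩ hab
        simp only [Finset.mem_filter, Finset.HasAntidiagonal.mem_antidiagonal] at hab
        rw [map_mul, map_mul, map_pow, map_neg, map_one, hps, ← h a, mul_comm,
          show N - b = a by omega]
    rw [h1] at h3
    obtain ⟨N, rfl⟩ := Nat.exists_eq_succ_of_ne_zero hN.ne'
    rw [Finset.sum_Icc_succ_top (by omega), Finset.sum_Icc_succ_top (by omega), Nat.sub_self,
      monicDeg_zero, Finset.sum_singleton, map_one, mul_one, mul_one, neg_add,
      Finset.sum_congr rfl (g := fun k => - ((∑ i, α i ^ k) * ∑ f ∈ monicDeg F (N + 1 - k), c f)) ?_,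
      Finset.sum_neg_distrib] at h3
    · exact add_left_cancel h3
    · intro k hk
      rw [Finset.mem_Icc] at hk
      rw [ih k (by omega) (by omega), neg_mul]

theorem exists_charPsi_eq_neg_sum_pow [IsAlgClosed Ω] (c : F[X] →* ℂ) {r : ℕ}
    (h : ∀ n > r, ∑ f ∈ monicDeg F n, c f = 0) :
    ∃ α : Fin r → ℂ, ∀ N > 0, charPsi Ω c N = - ∑ i, α i ^ N := by
  set A : ℕ → ℂ := fun n => ∑ f ∈ monicDeg F n, c f with hA
  have hA0 : A 0 = 1 := by simp [hA, monicDeg_zero]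
  set Q : ℂ[X] := ∑ n ∈ Finset.range (r + 1), monomial n (A (r - n)) with hQ
  have hcoeff : ∀ n ≤ r, Q.coeff n = A (r - n) := fun n hn => by
    simp [hQ, coeff_monomial, Nat.lt_succ_iff.2 hn]
  have hdeg : Q.natDegree = r := by
    refine natDegree_eq_of_le_of_coeff_ne_zero ?_ (by rw [hcoeff r le_rfl, Nat.sub_self, hA0]; exact one_ne_zero)
    refine natDegree_sum_le_of_forall_le _ _ fun n hn => (natDegree_monomial_le _).trans ?_
    exact Nat.lt_succ_iff.1 (Finset.mem_range.1 hn)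
  have hlead : Q.leadingCoeff = 1 := by
    rw [leadingCoeff, hdeg, hcoeff r le_rfl, Nat.sub_self, hA0]
  have hroots : Q.roots.card = Q.natDegree := (IsAlgClosed.splits Q).natDegree_eq_card_roots.symm
  obtain ⟨l, hl⟩ := Quot.exists_rep Q.roots
  have hlen : l.length = r := by
    rw [← hdeg, ← hroots, ← hl]; rfl
  refine ⟨fun i => l.get (Fin.cast hlen.symm i), fun N hN => charPsi_eq_neg_sum_pow Ω c _ ?_ hN⟩
  intro n
  have hval : (Finset.univ : Finset (Fin r)).val.map (fun i => l.get (Fin.cast hlen.symm i)) =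
      Q.roots := by
    subst hlen
    rw [Fin.univ_val_map, ← hl]
    exact congrArg _ (List.ofFn_get l)
  rw [MvPolynomial.aeval_esymm_eq_multiset_esymm, hval]
  rcases le_or_gt n r with hn | hn
  · have := coeff_eq_esymm_roots_of_card hroots (k := r - n) (by omega)
    rw [hcoeff _ (Nat.sub_le _ _), hlead, hdeg, Nat.sub_sub_self hn, one_mul] at this
    exact this
  · rw [h n hn, Multiset.esymm, Multiset.powersetCard_eq_empty _ (by rw [hroots, hdeg]; exact hn)]
    simp

end LFunction

/-- If the power sums of a finite family are `O(ρ ^ k)` then all members are at most `ρ` in norm. -/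
theorem norm_le_of_norm_sum_pow_le {ι : Type*} [Fintype ι] (β : ι → ℂ) {C ρ : ℝ} (hρ : 0 < ρ)
    {k₀ : ℕ} (h : ∀ k ≥ k₀, ‖∑ i, β i ^ k‖ ≤ C * ρ ^ k) (i : ι) : ‖β i‖ ≤ ρ := by
  classical
  set P : ℂ[X] := ∏ b ∈ (Finset.univ.image β).erase (β i), (X - Polynomial.C b) with hP
  have hPi : P.eval (β i) ≠ 0 := by
    rw [hP, eval_prod, Finset.prod_ne_zero_iff]
    intro b hb
    simpa [sub_eq_zero, eq_comm] using (Finset.mem_erase.1 hb).1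
  have hPj : ∀ j, β j ≠ β i → P.eval (β j) = 0 := by
    intro j hj
    rw [hP, eval_prod]
    exact Finset.prod_eq_zero (Finset.mem_erase.2 ⟨hj, Finset.mem_image_of_mem _ (Finset.mem_univ j)⟩)
      (by simp)
  set μ := (Finset.univ.filter fun j => β j = β i).card with hμ
  have hμ0 : 0 < μ := Finset.card_pos.2 ⟨i, by simp⟩
  have key : ∀ k, ∑ l ∈ P.support, P.coeff l * ∑ j, β j ^ (k + l) = μ * (β i ^ k * P.eval (β i)) := by
    intro k
    have h1 : ∀ j, β j ^ k * P.eval (β j) = if β j = β i then β i ^ k * P.eval (β i) else 0 := by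
      intro j
      split_ifs with hj
      · rw [hj]
      · rw [hPj j hj, mul_zero]
    rw [hμ, ← nsmul_eq_mul, ← Finset.sum_const, Finset.sum_filter, ← Finset.sum_congr rfl fun j _ => h1 j]
    simp only [Finset.mul_sum]
    rw [Finset.sum_comm]
    refine Finset.sum_congr rfl fun j _ => ?_
    rw [eval_eq_sum, Polynomial.sum, Finset.mul_sum]
    refine Finset.sum_congr rfl fun l _ => ?_
    ring
  set K := (∑ l ∈ P.support, ‖P.coeff l‖ * (C * ρ ^ l)) / (μ * ‖P.eval (β i)‖) with hK
  have hden : 0 < μ * ‖P.eval (β i)‖ := mul_pos (by exact_mod_cast hμ0) (norm_pos_iff.2 hPi)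
  have bound : ∀ k ≥ k₀, (‖β i‖ / ρ) ^ k ≤ K := by
    intro k hk
    rw [hK, le_div_iff₀ hden, div_pow, div_mul_eq_mul_div, div_le_iff₀ (pow_pos hρ k)]
    have h1 := congrArg norm (key k)
    rw [norm_mul, norm_mul, norm_pow, Complex.norm_natCast] at h1
    calc ‖β i‖ ^ k * (μ * ‖P.eval (β i)‖) = ‖∑ l ∈ P.support, P.coeff l * ∑ j, β j ^ (k + l)‖ := by
          rw [h1]; ring
      _ ≤ ∑ l ∈ P.support, ‖P.coeff l‖ * (C * ρ ^ (k + l)) := by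
          refine (norm_sum_le _ _).trans (Finset.sum_le_sum fun l _ => ?_)
          rw [norm_mul]
          exact mul_le_mul_of_nonneg_left (h _ (by omega)) (norm_nonneg _)
      _ = _ := by
          rw [Finset.sum_mul]
          refine Finset.sum_congr rfl fun l _ => ?_
          ring
  by_contra hlt
  push Not at hlt
  have h1 : 1 < ‖β i‖ / ρ := (one_lt_div hρ).2 hlt
  obtain ⟨k, hk⟩ := pow_unbounded_of_one_lt K h1
  have h2 := bound (k + k₀) (by omega)
  exact absurd (hk.trans_le (pow_le_pow_right₀ h1.le (Nat.le_add_right k k₀))) (not_lt.2 h2)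

/-- Upper bounds for all members of a family with a prescribed sum give asymptotics for each. -/
theorem norm_sub_le_of_upper_bounds {G : Type*} [Fintype G] (H : Finset G) (W : G → ℝ) (v : G → ℂ)
    (hv : ∀ γ, ‖v γ‖ ≤ 1) {Q r C D : ℝ} (hr : 0 ≤ r) (hC : 0 ≤ C)
    (h1 : ∀ γ ∈ H, H.card * W γ ≤ Q + C * r) (h2 : ∀ γ ∉ H, W γ ≤ C) (h3 : Q - D ≤ ∑ γ, W γ) :
    ‖H.card * ∑ γ, W γ * v γ - Q * ∑ γ ∈ H, v γ‖ ≤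
      H.card * (2 * (C * r) + 2 * (Fintype.card G * C) + D) := by
  classical
  set u : G → ℝ := fun γ => if γ ∈ H then C * r else H.card * C with hu
  set e : G → ℝ := fun γ => (if γ ∈ H then Q else 0) + u γ - H.card * W γ with he
  have hu0 : ∀ γ, 0 ≤ u γ := fun γ => by
    simp only [hu]
    split_ifs <;> positivity
  have he0 : ∀ γ, 0 ≤ e γ := fun γ => by
    simp only [he, hu]
    split_ifs with hγ
    · linarith [h1 γ hγ]
    · have := mul_le_mul_of_nonneg_left (h2 γ hγ) (Nat.cast_nonneg H.card : (0 : ℝ) ≤ _)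
      linarith
  have husum : ∑ γ, u γ ≤ H.card * (C * r + Fintype.card G * C) := by
    have : ∀ γ, u γ ≤ (if γ ∈ H then C * r else 0) + H.card * C := fun γ => by
      simp only [hu]
      split_ifs
      · have : 0 ≤ H.card * C := by positivity
        linarith
      · simp
    refine (Finset.sum_le_sum fun γ _ => this γ).trans ?_
    rw [Finset.sum_add_distrib, Finset.sum_ite_mem, Finset.univ_inter]
    simp only [Finset.sum_const, Finset.card_univ, nsmul_eq_mul]
    apply le_of_eq
    ring
  have hesum : ∑ γ, e γ = H.card * Q + ∑ γ, u γ - H.card * ∑ γ, W γ := by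
    simp only [he]
    rw [Finset.sum_sub_distrib, Finset.sum_add_distrib, Finset.sum_ite_mem, Finset.univ_inter,
      Finset.mul_sum]
    simp
  have hid : H.card * ∑ γ, W γ * v γ - Q * ∑ γ ∈ H, v γ = ∑ γ, (((u γ - e γ : ℝ)) : ℂ) * v γ := by
    have : ∑ γ ∈ H, v γ = ∑ γ, if γ ∈ H then v γ else 0 := by
      rw [Finset.sum_ite_mem, Finset.univ_inter]
    rw [this, Finset.mul_sum, Finset.mul_sum, ← Finset.sum_sub_distrib]
    refine Finset.sum_congr rfl fun γ _ => ?_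
    simp only [he]
    split_ifs <;> push_cast <;> ring
  rw [hid]
  calc _ ≤ ∑ γ, (u γ + e γ) := by
        refine (norm_sum_le _ _).trans (Finset.sum_le_sum fun γ _ => ?_)
        rw [norm_mul, Complex.norm_real]
        refine (mul_le_of_le_one_right (norm_nonneg _) (hv γ)).trans ?_
        rw [Real.norm_eq_abs, abs_le]
        constructor <;> linarith [hu0 γ, he0 γ]
    _ ≤ _ := by
        rw [Finset.sum_add_distrib, hesum]
        have := mul_le_mul_of_nonneg_left h3 (Nat.cast_nonneg H.card : (0 : ℝ) ≤ _)
        nlinarith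

section Modulus

variable {F Ω : Type*} [Field F] [Field Ω] [Algebra F Ω] {m : F[X]}

theorem finite_adjoinRoot [Finite F] (hm : m ≠ 0) : Finite (AdjoinRoot m) := by
  have := (AdjoinRoot.powerBasis hm).finite
  exact Module.finite_of_finite F

theorem isUnit_mk_iff_isCoprime {f : F[X]} : IsUnit (AdjoinRoot.mk m f) ↔ IsCoprime f m := by
  rw [isUnit_iff_exists_inv]
  constructor
  · rintro ⟨b, hb⟩
    obtain ⟨g, rfl⟩ := AdjoinRoot.mk_surjective b
    rw [← map_mul, ← map_one (AdjoinRoot.mk m), AdjoinRoot.mk_eq_mk] at hb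
    obtain ⟨w, hw⟩ := hb
    exact ⟨g, -w, by linear_combination hw⟩
  · rintro ⟨g, w, h⟩
    refine ⟨AdjoinRoot.mk m g, ?_⟩
    have := congrArg (AdjoinRoot.mk m) h
    rwa [map_add, map_mul, map_mul, AdjoinRoot.mk_self, mul_zero, add_zero, map_one, mul_comm] at this

theorem exists_mk_eq_natDegree_lt (hm : 0 < m.natDegree) (b : AdjoinRoot m) :
    ∃ r : F[X], AdjoinRoot.mk m r = b ∧ r.natDegree < m.natDegree := by
  obtain ⟨g, rfl⟩ := AdjoinRoot.mk_surjective b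
  refine ⟨g % m, ?_, natDegree_mod_lt g hm.ne'⟩
  rw [AdjoinRoot.mk_eq_mk]
  exact ⟨-(g / m), by linear_combination EuclideanDomain.mod_add_div g m⟩

/-- Monic polynomials of degree at least `deg m` are equidistributed modulo `m`. -/
theorem sum_monicDeg_eq_zero [Fintype F] [Fintype (AdjoinRoot m)] (hm : 0 < m.natDegree) (g : AdjoinRoot m → ℂ)
    (hg : ∑ b, g b = 0) {n : ℕ} (hn : m.natDegree ≤ n) :
    ∑ f ∈ monicDeg F n, g (AdjoinRoot.mk m f) = 0 := by
  have hshift : ∀ b, ∑ f ∈ monicDeg F n, g (AdjoinRoot.mk m f) =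
      ∑ f ∈ monicDeg F n, g (AdjoinRoot.mk m f + b) := by
    intro b
    obtain ⟨r, rfl, hr⟩ := exists_mk_eq_natDegree_lt hm b
    have hmem : ∀ r : F[X], r.natDegree < m.natDegree → ∀ f ∈ monicDeg F n, f + r ∈ monicDeg F n := by
      intro r hr f hf
      rw [mem_monicDeg] at hf ⊢
      have hlt : r.natDegree < f.natDegree := by omega
      exact ⟨hf.1.add_of_left (degree_lt_degree hlt), (natDegree_add_eq_left_of_natDegree_lt hlt).trans hf.2⟩
    refine Finset.sum_bij' (fun f _ => f + -r) (fun f _ => f + r)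
      (hmem _ (by rwa [natDegree_neg])) (hmem r hr) ?_ ?_ ?_
    · intro f _; ring
    · intro f _; ring
    · intro f _
      rw [← map_add, neg_add_cancel_right]
  have h1 : (Fintype.card (AdjoinRoot m) : ℂ) * ∑ f ∈ monicDeg F n, g (AdjoinRoot.mk m f) = 0 := by
    rw [← nsmul_eq_mul, ← Finset.card_univ, ← Finset.sum_const,
      Finset.sum_congr rfl fun b _ => hshift b, Finset.sum_comm]
    refine Finset.sum_eq_zero fun f _ => ?_
    rw [← hg]
    exact Fintype.sum_equiv (Equiv.addLeft (AdjoinRoot.mk m f)) _ _ fun b => rfl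
  have : Nontrivial (AdjoinRoot m) := AdjoinRoot.nontrivial m
    (natDegree_pos_iff_degree_pos.1 hm).ne'
  exact (mul_eq_zero.1 h1).resolve_left (by exact_mod_cast Fintype.card_ne_zero)

variable (m) in
/-- A character modulo `m` as a function on polynomials. -/
noncomputable def resChar (χ : MulChar (AdjoinRoot m) ℂ) : F[X] →* ℂ :=
  χ.toMonoidHom.comp (AdjoinRoot.mk m : F[X] →* AdjoinRoot m)

theorem resChar_apply (χ : MulChar (AdjoinRoot m) ℂ) (f : F[X]) :
    resChar m χ f = χ (AdjoinRoot.mk m f) := rfl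

variable [Fintype F]

theorem aeval_eq_zero_of_not_isUnit {x : Ω} {N : ℕ} (hN : 0 < N) (hx : x ^ Fintype.card F ^ N = x)
    (h : ¬ IsUnit (AdjoinRoot.mk m (normPoly F N x))) : aeval x m = 0 := by
  by_contra h0
  refine h (isUnit_mk_iff_isCoprime.2 (IsCoprime.pow_left ?_))
  rw [(minpoly.irreducible (isIntegral_of_pow_card_pow_eq hN hx)).coprime_iff_not_dvd]
  rintro ⟨g, rfl⟩
  exact h0 (by rw [map_mul, minpoly.aeval, zero_mul])

open Classical in
theorem card_filter_not_isUnit_le (hm : m ≠ 0) {N : ℕ} (hN : 0 < N) :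
    ((fixedPts F Ω N).filter fun x => ¬ IsUnit (AdjoinRoot.mk m (normPoly F N x))).card ≤
      m.natDegree := by
  refine (Finset.card_le_card (t := (m.map (algebraMap F Ω)).roots.toFinset) fun x hx => ?_).trans ?_
  · obtain ⟨h1, h2⟩ := Finset.mem_filter.1 hx
    rw [mem_fixedPts hN] at h1
    rw [Multiset.mem_toFinset, mem_roots (map_ne_zero hm), IsRoot, eval_map, ← aeval_def]
    exact aeval_eq_zero_of_not_isUnit hN h1 h2
  · refine (Multiset.toFinset_card_le _).trans ((card_roots' _).trans ?_)
    rw [natDegree_map]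

theorem isGood_root_iff {N : ℕ} (hN : 0 < N) {γ : Fˣ × (AdjoinRoot m)ˣ} {x : Ω} :
    IsGood (AdjoinRoot.root m) N γ x ↔ x ∈ fixedPts F Ω N ∧ x ≠ 0 ∧
      (normPoly F N x).eval 0 = γ.1 ∧ AdjoinRoot.mk m (normPoly F N x) = γ.2 := by
  rw [mem_fixedPts hN, IsGood]
  constructor
  · rintro ⟨h0, hx, f, hf, h1, h2⟩
    rw [← map_normPoly hN hx] at hf
    obtain rfl := map_injective _ (algebraMap F Ω).injective hf
    exact ⟨hx, h0, h1, by rwa [← AdjoinRoot.aeval_eq]⟩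
  · rintro ⟨hx, h0, h1, h2⟩
    exact ⟨h0, hx, _, map_normPoly hN hx, h1, by rwa [AdjoinRoot.aeval_eq]⟩

theorem eval_zero_normPoly_ne_zero {x : Ω} {N : ℕ} (hN : 0 < N) (hx : x ^ Fintype.card F ^ N = x)
    (h0 : x ≠ 0) : (normPoly F N x).eval 0 ≠ 0 := by
  intro h
  have h1 : ((normPoly F N x).map (algebraMap F Ω)).eval 0 = 0 := by rw [eval_zero_map, h, map_zero]
  rw [map_normPoly hN hx, eval_prod, Finset.prod_eq_zero_iff] at h1
  obtain ⟨i, -, hi⟩ := h1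
  rw [eval_sub, eval_X, eval_C, zero_sub, neg_eq_zero] at hi
  exact h0 (pow_eq_zero_iff (pow_ne_zero _ Fintype.card_ne_zero) |>.1 hi)

theorem charPsi_resChar_eq [Fintype (AdjoinRoot m)] [DecidableEq F] [Fintype (AdjoinRoot m)ˣ]
    (χ : MulChar (AdjoinRoot m) ℂ) {N : ℕ} (hN : 0 < N) :
    charPsi Ω (resChar m χ) N = resChar m χ (normPoly F N (0 : Ω)) +
      ∑ γ : Fˣ × (AdjoinRoot m)ˣ, ({x : Ω | IsGood (AdjoinRoot.root m) N γ x}.ncard : ℂ) * χ γ.2 := by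
  classical
  have h0 : (0 : Ω) ∈ fixedPts F Ω N := by
    rw [mem_fixedPts hN, zero_pow (pow_ne_zero _ Fintype.card_ne_zero)]
  rw [charPsi, ← Finset.add_sum_erase _ _ h0]
  congr 1
  have h1 : ∀ γ : Fˣ × (AdjoinRoot m)ˣ,
      ({x : Ω | IsGood (AdjoinRoot.root m) N γ x}.ncard : ℂ) * χ γ.2 =
      ∑ x ∈ (fixedPts F Ω N).erase 0, if (normPoly F N x).eval 0 = γ.1 ∧
        AdjoinRoot.mk m (normPoly F N x) = γ.2 then χ γ.2 else 0 := by
    intro γ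
    rw [← Finset.sum_filter, Finset.sum_const, nsmul_eq_mul, ← Set.ncard_coe_finset]
    congr 3
    ext x
    rw [Set.mem_ofPred_eq, isGood_root_iff hN]
    simp
    tauto
  rw [Finset.sum_congr rfl fun γ _ => h1 γ, Finset.sum_comm]
  refine Finset.sum_congr rfl fun x hx => ?_
  obtain ⟨hx0, hx⟩ := Finset.mem_erase.1 hx
  rw [mem_fixedPts hN] at hx
  rw [resChar_apply]
  by_cases hu : IsUnit (AdjoinRoot.mk m (normPoly F N x))
  · obtain ⟨u, hu⟩ := hu
    rw [Finset.sum_eq_single (Units.mk0 _ (eval_zero_normPoly_ne_zero hN hx hx0), u)]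
    · simp [hu]
    · intro γ _ hγ
      refine if_neg fun h => hγ ?_
      exact Prod.ext (Units.ext h.1.symm) (Units.ext (h.2.symm.trans hu.symm))
    · simp
  · rw [MulChar.map_nonunit _ hu, Finset.sum_eq_zero]
    intro γ _
    refine if_neg fun h => hu ?_
    rw [h.2]
    exact γ.2.isUnit

end Modulus

section Bound

theorem norm_mulChar_unit {B : Type*} [CommRing B] [Finite B] (χ : MulChar B ℂ) (u : Bˣ) : ‖χ u‖ = 1 := by
  have := Fintype.ofFinite Bˣ
  refine Complex.norm_eq_one_of_pow_eq_one (n := Fintype.card Bˣ) ?_ Fintype.card_ne_zero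
  rw [← map_pow, ← Units.val_pow_eq_pow_val, pow_card_eq_one, Units.val_one, map_one]

theorem norm_mulChar_le_one {B : Type*} [CommRing B] [Finite B] (χ : MulChar B ℂ) (b : B) : ‖χ b‖ ≤ 1 := by
  by_cases hb : IsUnit b
  · obtain ⟨u, rfl⟩ := hb
    exact (norm_mulChar_unit χ u).le
  · rw [MulChar.map_nonunit _ hb, norm_zero]
    exact zero_le_one

variable {F : Type*} (Ω : Type*) [Field F] [Fintype F] [Field Ω] [IsAlgClosed Ω] [Algebra F Ω] {m : F[X]}

theorem charPsi_resChar_one (N : ℕ) (hm : m ≠ 0) (hN : 0 < N) :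
    ∃ E ≤ m.natDegree, charPsi Ω (resChar m 1) N = (Fintype.card F : ℂ) ^ N - E := by
  classical
  refine ⟨_, card_filter_not_isUnit_le (F := F) (Ω := Ω) hm hN, ?_⟩
  rw [eq_sub_iff_add_eq, charPsi]
  have h1 : ∑ x ∈ fixedPts F Ω N, resChar m 1 (normPoly F N x) =
      (((fixedPts F Ω N).filter fun x => IsUnit (AdjoinRoot.mk m (normPoly F N x))).card : ℂ) := by
    rw [Finset.card_filter, Nat.cast_sum]
    refine Finset.sum_congr rfl fun x _ => ?_
    rw [resChar_apply]
    split_ifs with h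
    · rw [MulChar.one_apply h, Nat.cast_one]
    · rw [MulChar.map_nonunit _ h, Nat.cast_zero]
  rw [h1, ← Nat.cast_add, Finset.card_filter_add_card_filter_not, card_fixedPts hN]
  push_cast
  rfl

theorem exists_norm_charPsi_sub_le (hm : 0 < m.natDegree) (χ : MulChar (AdjoinRoot m) ℂ) :
    ∃ (ε : Bool) (C : ℝ) (k₀ : ℕ), ∀ k ≥ k₀,
      ‖charPsi Ω (resChar m χ) (2 * k) - if ε then (Fintype.card F : ℂ) ^ (2 * k) else 0‖ ≤
        C * (Fintype.card F : ℝ) ^ k := by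
  classical
  have hm0 : m ≠ 0 := by rintro rfl; simp at hm
  have := finite_adjoinRoot hm0
  have := Fintype.ofFinite (AdjoinRoot m)
  have := Fintype.ofFinite (AdjoinRoot m)ˣ
  obtain ⟨H, C, k₀, h⟩ := exists_subgroup_ncard_good_le
    (Algebra.leftMulMatrix (AdjoinRoot.powerBasis hm0).basis)
    (Algebra.leftMulMatrix_injective _) (AdjoinRoot.root m) Ω
  set q : ℝ := (Fintype.card F : ℝ) with hq
  have hq1 : 1 ≤ q := by rw [hq]; exact_mod_cast Fintype.card_pos (α := F)
  set S : Finset (Fˣ × (AdjoinRoot m)ˣ) := Finset.univ.filter (· ∈ H) with hS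
  have hcard : S.card = Nat.card H := by
    rw [hS, ← Fintype.card_subtype, Nat.card_eq_fintype_card]
  have hcard0 : (0 : ℝ) < S.card := by
    rw [hcard]; exact_mod_cast Nat.card_pos
  let ψ : H →* ℂ := (χ.toMonoidHom.comp (Units.coeHom (AdjoinRoot m))).comp
    ((MonoidHom.snd Fˣ (AdjoinRoot m)ˣ).comp H.subtype)
  have hsum : ∑ γ ∈ S, χ γ.2 = if ψ = 1 then (S.card : ℂ) else 0 := by
    have h1 := sum_hom_units ψ
    rw [hcard, Nat.card_eq_fintype_card]
    rw [Nat.cast_ite, Nat.cast_zero] at h1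
    rw [← h1]
    exact (Finset.sum_subtype S (fun γ => by simp [hS]) (fun γ => χ γ.2))
  set D : ℝ := m.natDegree + 1
  refine ⟨decide (ψ = 1), 2 * C + 2 * (Fintype.card (Fˣ × (AdjoinRoot m)ˣ) * C) + D + 1,
    k₀ + 1, fun k hk => ?_⟩
  have hk2 : 0 < 2 * k := by omega
  set W : Fˣ × (AdjoinRoot m)ˣ → ℝ := fun γ =>
    ({x : Ω | IsGood (AdjoinRoot.root m) (2 * k) γ x}.ncard : ℝ) with hW
  have hpsi : ∀ χ : MulChar (AdjoinRoot m) ℂ, charPsi Ω (resChar m χ) (2 * k) =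
      resChar m χ (normPoly F (2 * k) (0 : Ω)) + ∑ γ, (W γ : ℂ) * χ γ.2 := by
    intro χ
    rw [charPsi_resChar_eq χ hk2]
    simp [hW]
  have hqk : 1 ≤ q ^ k := one_le_pow₀ hq1
  have h3 : q ^ (2 * k) - D ≤ ∑ γ, W γ := by
    obtain ⟨E, hE, h4⟩ := charPsi_resChar_one Ω (2 * k) hm0 hk2
    rw [hpsi] at h4
    have h5 : ∑ γ, (W γ : ℂ) * (1 : MulChar (AdjoinRoot m) ℂ) γ.2 = ((∑ γ, W γ : ℝ) : ℂ) := by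
      push_cast
      exact Finset.sum_congr rfl fun γ _ => by rw [MulChar.one_apply_coe, mul_one]
    rw [h5] at h4
    have h6 := congrArg Complex.re h4
    have h7 := (Complex.re_le_norm _).trans
      (norm_mulChar_le_one 1 (AdjoinRoot.mk m (normPoly F (2 * k) (0 : Ω))))
    rw [← resChar_apply] at h7
    have h8 : ((Fintype.card F : ℂ) ^ (2 * k) - E).re = q ^ (2 * k) - E := by
      rw [hq, Complex.sub_re, ← Nat.cast_pow, Complex.natCast_re, Complex.natCast_re]
      push_cast
      rfl
    rw [h8, Complex.add_re, Complex.ofReal_re] at h6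
    have hE : (E : ℝ) ≤ m.natDegree := by exact_mod_cast hE
    simp only [D]
    linarith
  have h1 : ∀ γ ∈ S, S.card * W γ ≤ q ^ (2 * k) + C * q ^ k := by
    intro γ hγ
    have := (h k (by omega) γ).1 (by simpa [hS] using hγ)
    simp only [hcard, hW, hq]
    exact_mod_cast this
  have h2 : ∀ γ ∉ S, W γ ≤ C := by
    intro γ hγ
    have := (h k (by omega) γ).2 (by simpa [hS] using hγ)
    simp only [hW]
    exact_mod_cast this
  have key := norm_sub_le_of_upper_bounds S W (fun γ => χ γ.2) (fun γ => norm_mulChar_le_one χ _)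
    (zero_le_one.trans hqk) (Nat.cast_nonneg C) h1 h2 h3
  rw [hsum] at key
  have hfac : (S.card : ℂ) * ∑ γ, (W γ : ℂ) * χ γ.2 - ((q ^ (2 * k) : ℝ) : ℂ) *
      (if ψ = 1 then (S.card : ℂ) else 0) = S.card * (∑ γ, (W γ : ℂ) * χ γ.2 -
        if decide (ψ = 1) then (Fintype.card F : ℂ) ^ (2 * k) else 0) := by
    simp only [decide_eq_true_eq, hq]
    split_ifs <;> push_cast <;> ring
  rw [hfac, norm_mul, Complex.norm_natCast] at key
  have key := le_of_mul_le_mul_left key hcard0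
  rw [hpsi, add_sub_assoc]
  refine (norm_add_le _ _).trans ((add_le_add (norm_mulChar_le_one χ _) key).trans ?_)
  have hD : 0 ≤ D := by positivity
  have hC : (0 : ℝ) ≤ Fintype.card (Fˣ × (AdjoinRoot m)ˣ) * C := by positivity
  nlinarith

/-- **The Riemann hypothesis** for Dirichlet `L`-functions over `F[X]`. -/
theorem norm_charPsi_le (hm : 0 < m.natDegree) {χ : MulChar (AdjoinRoot m) ℂ} (hχ : χ ≠ 1) {N : ℕ}
    (hN : 0 < N) : ‖charPsi Ω (resChar m χ) N‖ ≤
      (m.natDegree - 1) * √((Fintype.card F : ℝ) ^ N) := by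
  have hm0 : m ≠ 0 := by rintro rfl; simp at hm
  have := finite_adjoinRoot hm0
  have := Fintype.ofFinite (AdjoinRoot m)
  obtain ⟨α, hα⟩ := exists_charPsi_eq_neg_sum_pow Ω (resChar m χ) (r := m.natDegree - 1)
    fun n hn => sum_monicDeg_eq_zero hm χ (MulChar.sum_eq_zero_of_ne_one hχ) (by omega)
  set q : ℝ := (Fintype.card F : ℝ) with hq
  have hq1 : 1 < q := by rw [hq]; exact_mod_cast Fintype.one_lt_card (α := F)
  have hq0 : 0 < q := zero_lt_one.trans hq1
  obtain ⟨ε, C, k₀, h⟩ := exists_norm_charPsi_sub_le Ω hm χ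
  have hbound : ∀ i, ‖α i ^ 2‖ ≤ q := by
    cases ε with
    | false =>
      refine norm_le_of_norm_sum_pow_le (fun i => α i ^ 2) hq0 (k₀ := k₀ + 1) (C := C) fun k hk => ?_
      have h1 := h k (by omega)
      rw [hα _ (by omega)] at h1
      simpa [pow_mul] using h1
    | true =>
      have h1 := norm_le_of_norm_sum_pow_le
        (fun i : Option (Fin (m.natDegree - 1)) => i.elim ((q : ℂ) ^ 2) fun i => α i ^ 2) hq0
        (k₀ := k₀ + 1) (C := C) (fun k hk => by
          have h1 := h k (by omega)
          rw [hα _ (by omega)] at h1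
          rw [Fintype.sum_option]
          simp only [Option.elim, ← pow_mul]
          rw [if_pos rfl, ← neg_add', norm_neg, add_comm] at h1
          simpa [hq] using h1) none
      simp only [Option.elim, norm_pow, Complex.norm_real, Real.norm_of_nonneg hq0.le] at h1
      nlinarith
  rw [hα N hN, norm_neg]
  refine (norm_sum_le _ _).trans ((Finset.sum_le_card_nsmul _ _ (√(q ^ N)) fun i _ => ?_).trans ?_)
  · refine Real.le_sqrt_of_sq_le ?_
    rw [norm_pow, ← pow_mul, mul_comm, pow_mul]
    exact pow_le_pow_left₀ (by positivity) (by simpa using hbound i) N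
  · rw [Finset.card_univ, Fintype.card_fin, nsmul_eq_mul, Nat.cast_sub hm, Nat.cast_one]

end Bound

section Counting

theorem natCard_units_adjoinRoot {F : Type*} [Field F] {m : F[X]} (hm : 0 < m.natDegree) :
    Nat.card {p : F[X] // p.degree < (m.natDegree : ℕ) ∧ IsCoprime p m} =
      Nat.card (AdjoinRoot m)ˣ := by
  have hm0 : m ≠ 0 := by rintro rfl; simp at hm
  refine Nat.card_congr (Equiv.ofBijective
    (fun p => (isUnit_mk_iff_isCoprime.2 p.2.2).unit) ⟨?_, ?_⟩)
  · rintro ⟨p, hp, hpm⟩ ⟨r, hr, hrm⟩ h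
    have h1 : AdjoinRoot.mk m p = AdjoinRoot.mk m r := congrArg Units.val h
    rw [AdjoinRoot.mk_eq_mk] at h1
    refine Subtype.ext (sub_eq_zero.1 (eq_zero_of_dvd_of_degree_lt h1 ?_))
    rw [degree_eq_natDegree hm0]
    exact (degree_sub_le _ _).trans_lt (max_lt hp hr)
  · intro u
    obtain ⟨r, hr, hlt⟩ := exists_mk_eq_natDegree_lt hm (u : AdjoinRoot m)
    refine ⟨⟨r, ?_, isUnit_mk_iff_isCoprime.1 (hr ▸ u.isUnit)⟩, Units.ext hr⟩
    exact degree_le_natDegree.trans_lt (by exact_mod_cast hlt)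

theorem sum_mulChar_apply {B : Type*} [CommRing B] [Finite B] [Fintype (MulChar B ℂ)] [DecidableEq B]
    (b : B) : ∑ χ : MulChar B ℂ, χ b = if b = 1 then (Nat.card Bˣ : ℂ) else 0 := by
  split_ifs with h
  · simp only [h, map_one, Finset.sum_const, Finset.card_univ, nsmul_eq_mul, mul_one]
    rw [← MulChar.card_eq_card_units_of_hasEnoughRootsOfUnity B ℂ, Nat.card_eq_fintype_card]
  · obtain ⟨χ, hχ⟩ := MulChar.exists_apply_ne_one_of_hasEnoughRootsOfUnity B ℂ h
    refine eq_zero_of_mul_eq_self_left hχ ?_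
    simp only [Finset.mul_sum, ← MulChar.mul_apply]
    exact Fintype.sum_bijective _ (Group.mulLeft_bijective χ) _ _ fun χ' => rfl

variable {F : Type*} (Ω : Type*) [Field F] [Fintype F] [Field Ω] [Algebra F Ω] {m : F[X]}

open Classical in
theorem card_units_mul_card_filter_eq (hm : m ≠ 0) (u : (AdjoinRoot m)ˣ) (N : ℕ)
    [Fintype (MulChar (AdjoinRoot m) ℂ)] :
    (Nat.card (AdjoinRoot m)ˣ : ℂ) *
        ((fixedPts F Ω N).filter fun x => AdjoinRoot.mk m (normPoly F N x) = u).card =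
      ∑ χ : MulChar (AdjoinRoot m) ℂ, χ (u⁻¹ : (AdjoinRoot m)ˣ) * charPsi Ω (resChar m χ) N := by
  have := finite_adjoinRoot hm
  simp only [charPsi, Finset.mul_sum]
  rw [Finset.sum_comm, Finset.card_filter, Nat.cast_sum, Finset.mul_sum]
  refine Finset.sum_congr rfl fun x _ => ?_
  simp only [resChar_apply, ← map_mul]
  rw [sum_mulChar_apply]
  simp only [Units.inv_mul_eq_one, eq_comm (a := (u : AdjoinRoot m))]
  split_ifs <;> simp

variable [IsAlgClosed Ω]

open Classical in
/-- The prime number theorem in arithmetic progressions, counting points of the field with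
`(card F) ^ N` elements by the residue class of their characteristic polynomial. -/
theorem abs_card_units_mul_card_filter_sub_le (hm : 0 < m.natDegree) (u : (AdjoinRoot m)ˣ) {N : ℕ}
    (hN : 0 < N) :
    |(Nat.card (AdjoinRoot m)ˣ : ℝ) *
        ((fixedPts F Ω N).filter fun x => AdjoinRoot.mk m (normPoly F N x) = u).card -
          (Fintype.card F : ℝ) ^ N| ≤
      m.natDegree + (Nat.card (AdjoinRoot m)ˣ - 1) *
        ((m.natDegree - 1) * √((Fintype.card F : ℝ) ^ N)) := by
  have hm0 : m ≠ 0 := by rintro rfl; simp at hm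
  have := finite_adjoinRoot hm0
  have := Fintype.ofFinite (MulChar (AdjoinRoot m) ℂ)
  have h := card_units_mul_card_filter_eq Ω hm0 u N
  obtain ⟨E, hE, h1⟩ := charPsi_resChar_one Ω N hm0 hN
  rw [← Finset.add_sum_erase _ _ (Finset.mem_univ 1), h1, MulChar.one_apply_coe, one_mul] at h
  have hsum : ‖∑ χ ∈ Finset.univ.erase (1 : MulChar (AdjoinRoot m) ℂ),
      χ (u⁻¹ : (AdjoinRoot m)ˣ) * charPsi Ω (resChar m χ) N‖ ≤ (Nat.card (AdjoinRoot m)ˣ - 1) *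
        ((m.natDegree - 1) * √((Fintype.card F : ℝ) ^ N)) := by
    refine (norm_sum_le _ _).trans ((Finset.sum_le_card_nsmul _ _
      ((m.natDegree - 1) * √((Fintype.card F : ℝ) ^ N)) fun χ hχ => ?_).trans ?_)
    · rw [norm_mul, norm_mulChar_unit, one_mul]
      exact norm_charPsi_le Ω hm (Finset.ne_of_mem_erase hχ) hN
    · rw [Finset.card_erase_of_mem (Finset.mem_univ _), Finset.card_univ, nsmul_eq_mul,
        Nat.cast_sub Fintype.card_pos, Nat.cast_one, ← Nat.card_eq_fintype_card,
        MulChar.card_eq_card_units_of_hasEnoughRootsOfUnity]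
  have h2 : (((Nat.card (AdjoinRoot m)ˣ : ℝ) *
        ((fixedPts F Ω N).filter fun x => AdjoinRoot.mk m (normPoly F N x) = u).card -
          (Fintype.card F : ℝ) ^ N : ℝ) : ℂ) = -(E : ℂ) +
      ∑ χ ∈ Finset.univ.erase (1 : MulChar (AdjoinRoot m) ℂ),
        χ (u⁻¹ : (AdjoinRoot m)ˣ) * charPsi Ω (resChar m χ) N := by
    push_cast
    rw [h]
    ring
  rw [← Real.norm_eq_abs, ← Complex.norm_real, h2]
  refine (norm_add_le _ _).trans (add_le_add ?_ hsum)
  rw [norm_neg, Complex.norm_natCast]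
  exact_mod_cast hE

/-- Few points of the field with `(card F) ^ N` elements lie in a proper subfield. -/
theorem card_filter_natDegree_minpoly_ne_le {N : ℕ} (hN : 0 < N) :
    (((fixedPts F Ω N).filter fun x => (minpoly F x).natDegree ≠ N).card : ℝ) ≤
      2 * √((Fintype.card F : ℝ) ^ N) - 2 := by
  classical
  have hsub : ((fixedPts F Ω N).filter fun x => (minpoly F x).natDegree ≠ N) ⊆
      (Finset.Icc 1 (N / 2)).biUnion fun d => fixedPts F Ω d := by
    intro x hx
    rw [Finset.mem_filter, mem_fixedPts hN] at hx
    have hxi := isIntegral_of_pow_card_pow_eq hN hx.1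
    have hdvd := (pow_card_pow_eq_iff_natDegree_dvd hxi).1 hx.1
    have hpos := minpoly.natDegree_pos hxi
    refine Finset.mem_biUnion.2 ⟨(minpoly F x).natDegree, Finset.mem_Icc.2 ⟨hpos, ?_⟩, ?_⟩
    · obtain ⟨c, hc⟩ := hdvd
      have hc2 : 2 ≤ c := by
        rcases c with _ | _ | c
        · omega
        · exact absurd (by simpa using hc.symm) hx.2
        · omega
      rw [Nat.le_div_iff_mul_le two_pos]
      exact (Nat.mul_le_mul_left _ hc2).trans hc.ge
    · rw [mem_fixedPts hpos, pow_card_pow_eq_iff_natDegree_dvd hxi]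
  have hcard := (Finset.card_le_card hsub).trans Finset.card_biUnion_le
  have hgeom : ∀ k, ∑ d ∈ Finset.Icc 1 k, (fixedPts F Ω d).card + 2 ≤ 2 * Fintype.card F ^ k := by
    intro k
    induction k with
    | zero => simp
    | succ k ih =>
      rw [Finset.sum_Icc_succ_top (by omega), card_fixedPts k.succ_pos, pow_succ]
      have := Nat.mul_le_mul_left (Fintype.card F ^ k) (Fintype.one_lt_card (α := F))
      omega
  have h : (((fixedPts F Ω N).filter fun x => (minpoly F x).natDegree ≠ N).card : ℝ) + 2 ≤
      2 * (Fintype.card F : ℝ) ^ (N / 2) := by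
    exact_mod_cast (Nat.add_le_add_right hcard 2).trans (hgeom (N / 2))
  have hs : (Fintype.card F : ℝ) ^ (N / 2) ≤ √((Fintype.card F : ℝ) ^ N) := by
    refine Real.le_sqrt_of_sq_le ?_
    rw [← pow_mul]
    exact pow_le_pow_right₀ (by exact_mod_cast Fintype.card_pos (α := F)) (Nat.div_mul_le_self N 2)
  linarith

/-- Every monic irreducible polynomial of degree `N` is the minimal polynomial of exactly `N` points
of the field with `(card F) ^ N` elements. -/
theorem card_filter_minpoly_eq [DecidableEq F[X]] {P : F[X]} (hmon : P.Monic) (hirr : Irreducible P) {N : ℕ}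
    (hdeg : P.natDegree = N) : ((fixedPts F Ω N).filter fun x => minpoly F x = P).card = N := by
  classical
  have hN : 0 < N := hdeg ▸ hirr.natDegree_pos
  have heq : ((fixedPts F Ω N).filter fun x => minpoly F x = P) = (P.rootSet Ω).toFinset := by
    ext x
    rw [Finset.mem_filter, mem_fixedPts hN, Set.mem_toFinset, mem_rootSet_of_ne hmon.ne_zero]
    constructor
    · rintro ⟨-, rfl⟩
      exact minpoly.aeval F x
    · intro hx
      have hmin := minpoly.eq_of_irreducible_of_monic hirr hx hmon
      refine ⟨?_, hmin.symm⟩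
      rw [pow_card_pow_eq_iff_natDegree_dvd ⟨P, hmon, hx⟩, ← hmin, hdeg]
  rw [heq, Set.toFinset_card, card_rootSet_eq_natDegree
    (PerfectField.separable_of_irreducible hirr) (IsAlgClosed.splits _), hdeg]

open Classical in
theorem card_filter_mk_eq_and_natDegree_eq (u : AdjoinRoot m) {N : ℕ} (hN : 0 < N) :
    ((fixedPts F Ω N).filter fun x =>
      AdjoinRoot.mk m (normPoly F N x) = u ∧ (minpoly F x).natDegree = N).card =
      N * ((monicDeg F N).filter fun f => Irreducible f ∧ AdjoinRoot.mk m f = u).card := by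
  have hnorm : ∀ x : Ω, (minpoly F x).natDegree = N → normPoly F N x = minpoly F x := fun x hx => by
    rw [normPoly, hx, Nat.div_self hN, pow_one]
  rw [Finset.card_eq_sum_card_fiberwise (f := minpoly F)
    (t := (monicDeg F N).filter fun f => Irreducible f ∧ AdjoinRoot.mk m f = u), mul_comm,
    ← smul_eq_mul, ← Finset.sum_const]
  · refine Finset.sum_congr rfl fun P hP => ?_
    rw [Finset.mem_filter, mem_monicDeg] at hP
    obtain ⟨⟨hmon, hdeg⟩, hirr, hPu⟩ := hP
    rw [Finset.filter_filter]
    refine Eq.trans (congrArg Finset.card ?_) (card_filter_minpoly_eq Ω hmon hirr hdeg)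
    ext x
    simp only [Finset.mem_filter, and_congr_right_iff, and_iff_right_iff_imp]
    rintro - rfl
    exact ⟨by rw [hnorm x hdeg, hPu], hdeg⟩
  · intro x hx
    rw [Finset.mem_coe, Finset.mem_filter, mem_fixedPts hN] at hx
    obtain ⟨hx, hxu, hdeg⟩ := hx
    have hxi := isIntegral_of_pow_card_pow_eq hN hx
    rw [Finset.mem_coe, Finset.mem_filter, mem_monicDeg]
    exact ⟨⟨minpoly.monic hxi, hdeg⟩, minpoly.irreducible hxi, by rw [← hnorm x hdeg, hxu]⟩

end Counting

end Stepanov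

/-- function-field Dirichlet theorem with effective error term:
`|S_N(a,m) − q^N/(Φ(m)·N)| ≤ (M+1)·q^{N/2}/N`, where `S_N(a,m)` counts monic irreducible
polynomials of degree `N` congruent to `a` mod `m`, and `Φ(m)` counts polynomials of degree
less than `M = deg m` coprime to `m`. -/
theorem stmt4 (Fq : Type) [Field Fq] [Fintype Fq]
    (a m : Polynomial Fq) (M : ℕ) (hM : m.natDegree = M) (hMpos : 0 < M)
    (hcop : IsCoprime a m) (N : ℕ) (hN : 0 < N)
    (S Φ : ℕ)
    (hS : S = Nat.card {f : Polynomial Fq //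
      f.Monic ∧ Irreducible f ∧ f.natDegree = N ∧ m ∣ f - a})
    (hΦ : Φ = Nat.card {p : Polynomial Fq // p.degree < (M : ℕ) ∧ IsCoprime p m}) :
    |(S : ℝ) - (Fintype.card Fq : ℝ) ^ N / (Φ * N)| ≤
      (M + 1) * Real.sqrt ((Fintype.card Fq : ℝ) ^ N) / N := by
  classical
  subst hM
  have hm0 : m ≠ 0 := by rintro rfl; simp at hMpos
  obtain ⟨u, hu⟩ := Stepanov.isUnit_mk_iff_isCoprime.2 hcop
  rw [Stepanov.natCard_units_adjoinRoot hMpos] at hΦ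
  have := Stepanov.finite_adjoinRoot hm0
  let Ω := AlgebraicClosure Fq
  let T := Stepanov.fixedPts Fq Ω N
  have hS' : N * S = (T.filter fun x =>
      AdjoinRoot.mk m (Stepanov.normPoly Fq N x) = u ∧ (minpoly Fq x).natDegree = N).card := by
    rw [Stepanov.card_filter_mk_eq_and_natDegree_eq Ω _ hN, hS]
    congr 1
    refine Nat.subtype_card _ fun f => ?_
    rw [Finset.mem_filter, Stepanov.mem_monicDeg, hu, AdjoinRoot.mk_eq_mk]
    tauto
  have hsplit := Finset.card_filter_add_card_filter_not (s := T.filter fun x =>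
    AdjoinRoot.mk m (Stepanov.normPoly Fq N x) = u) fun x => (minpoly Fq x).natDegree = N
  rw [Finset.filter_filter, ← hS'] at hsplit
  set ψ := (T.filter fun x => AdjoinRoot.mk m (Stepanov.normPoly Fq N x) = u).card
  have hrest := (Nat.cast_le (α := ℝ)).2 (Finset.card_le_card (Finset.filter_subset_filter
    (fun x => ¬ (minpoly Fq x).natDegree = N)
    (Finset.filter_subset (fun x => AdjoinRoot.mk m (Stepanov.normPoly Fq N x) = u) T)))
  replace hrest := hrest.trans (Stepanov.card_filter_natDegree_minpoly_ne_le Ω hN)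
  have hmain := Stepanov.abs_card_units_mul_card_filter_sub_le Ω hMpos u hN
  rw [← hΦ] at hmain
  have hΦ1 : (1 : ℝ) ≤ Φ := by rw [hΦ]; exact_mod_cast Nat.card_pos
  have hM1 : (1 : ℝ) ≤ m.natDegree := by exact_mod_cast hMpos
  have hN0 : (0 : ℝ) < N := by exact_mod_cast hN
  have hs1 : 1 ≤ √((Fintype.card Fq : ℝ) ^ N) :=
    Real.one_le_sqrt.2 (one_le_pow₀ (by exact_mod_cast Fintype.card_pos (α := Fq)))
  set s := √((Fintype.card Fq : ℝ) ^ N)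
  set Q := (Fintype.card Fq : ℝ) ^ N
  have hψ : |(ψ : ℝ) - Q / Φ| ≤ (m.natDegree - 1) * s + 1 := by
    rw [show (ψ : ℝ) - Q / Φ = (Φ * ψ - Q) / Φ by field_simp, abs_div,
      abs_of_pos (zero_lt_one.trans_le hΦ1), div_le_iff₀ (zero_lt_one.trans_le hΦ1)]
    refine hmain.trans ?_
    nlinarith [mul_nonneg (sub_nonneg.2 hM1) (sub_nonneg.2 hs1)]
  have hle : (N : ℝ) * S ≤ ψ := by exact_mod_cast Nat.le.intro hsplit
  have hsplit := congrArg (Nat.cast (R := ℝ)) hsplit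
  rw [Nat.cast_add, Nat.cast_mul] at hsplit
  rw [show (S : ℝ) - Q / (Φ * N) = (N * S - Q / Φ) / N by field_simp, abs_div, abs_of_pos hN0]
  refine div_le_div_of_nonneg_right ?_ hN0.le
  rw [abs_le] at hψ ⊢
  constructor <;> linarith
end

section
/- Let K be a field containing a primitive n-th root of unity ε and let a, b ∈ K*. Then the symbol algebra (a,b;K,ε), generated over K by u, v with relations uⁿ = a, vⁿ = b, uv = ε·vu, is a central simple K-algebra of dimension n² over K. -/
set_option synthInstance.maxHeartbeats 1000000
set_option maxHeartbeats 1000000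

open scoped TensorProduct

/-- The defining relations of the symbol algebra `(a,b;K,ε)`: generators `u = ι 0`, `v = ι 1`
with `uⁿ = a`, `vⁿ = b`, `uv = ε·vu`. -/
def SymbolRel (K : Type) [Field K] (n : ℕ) (ε a b : K) :
    FreeAlgebra K (Fin 2) → FreeAlgebra K (Fin 2) → Prop := fun p q =>
  (p = (FreeAlgebra.ι K (0 : Fin 2)) ^ n ∧ q = algebraMap K _ a) ∨
  (p = (FreeAlgebra.ι K (1 : Fin 2)) ^ n ∧ q = algebraMap K _ b) ∨
  (p = FreeAlgebra.ι K (0 : Fin 2) * FreeAlgebra.ι K (1 : Fin 2) ∧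
    q = algebraMap K _ ε * (FreeAlgebra.ι K (1 : Fin 2) * FreeAlgebra.ι K (0 : Fin 2)))

/-- The symbol algebra `(a,b;K,ε)`. -/
noncomputable def SymbolAlgebra (K : Type) [Field K] (n : ℕ) (ε a b : K) : Type :=
  RingQuot (SymbolRel K n ε a b)

noncomputable instance (K : Type) [Field K] (n : ℕ) (ε a b : K) :
    Ring (SymbolAlgebra K n ε a b) := by unfold SymbolAlgebra; infer_instance

noncomputable instance (K : Type) [Field K] (n : ℕ) (ε a b : K) :
    Algebra K (SymbolAlgebra K n ε a b) := by unfold SymbolAlgebra; infer_instance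

namespace SymbolAlgebra

section Averaging

variable {K A : Type*} [Field K] [Ring A] [Algebra K A]

/-- The weighted sum `∑ k < n, νᵏ • Tᵏ`, which for `νⁿ = 1` and `Tⁿ = 1` is `n` times the
projection onto the `ν⁻¹`-eigenspace of `T`. -/
def weightedSum (n : ℕ) (T : Module.End K A) (ν : K) : Module.End K A :=
  ∑ k ∈ Finset.range n, ν ^ k • T ^ k

theorem pow_apply_of_eigen {T : Module.End K A} {μ : K} {m : A} (h : T m = μ • m) (k : ℕ) :
    (T ^ k) m = μ ^ k • m := by
  induction k with
  | zero => simp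
  | succ k ih => rw [pow_succ', Module.End.mul_apply, ih, map_smul, h, smul_smul, pow_succ]

theorem weightedSum_apply (n : ℕ) (T : Module.End K A) (ν : K) (x : A) :
    weightedSum n T ν x = ∑ k ∈ Finset.range n, ν ^ k • (T ^ k) x := by
  simp [weightedSum]

theorem weightedSum_apply_primitiveRoot {n : ℕ} {ε : K} (hε : IsPrimitiveRoot ε n)
    {T : Module.End K A} {m : A} {j q : Fin n} (h : T m = ε ^ (j : ℕ) • m) :
    weightedSum n T (ε ^ (q : ℕ))⁻¹ m = (if j = q then (n : K) else 0) • m := by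
  have hn : n ≠ 0 := (Fin.pos j).ne'
  have hε0 : ε ≠ 0 := hε.ne_zero hn
  simp only [weightedSum_apply, pow_apply_of_eigen h, smul_smul, ← mul_pow, ← Finset.sum_smul]
  congr 1
  split_ifs with hjq
  · subst hjq
    simp [inv_mul_cancel₀ (pow_ne_zero _ hε0)]
  · have h1 : (ε ^ (q : ℕ))⁻¹ * ε ^ (j : ℕ) ≠ 1 := by
      intro h1
      rw [inv_mul_eq_one₀ (pow_ne_zero _ hε0)] at h1
      exact hjq (Fin.ext (hε.pow_inj j.2 q.2 h1.symm))
    have h2 : ((ε ^ (q : ℕ))⁻¹ * ε ^ (j : ℕ)) ^ n = 1 := by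
      rw [mul_pow, inv_pow, pow_right_comm, hε.pow_eq_one, pow_right_comm, hε.pow_eq_one]
      simp
    have h3 := mul_geom_sum ((ε ^ (q : ℕ))⁻¹ * ε ^ (j : ℕ)) n
    rw [h2, sub_self] at h3
    exact (mul_eq_zero.1 h3).resolve_left (sub_ne_zero.2 h1)

theorem weightedSum_mem (n : ℕ) {T : Module.End K A} {I : TwoSidedIdeal A}
    (hT : ∀ x ∈ I, T x ∈ I) (ν : K) {x : A} (hx : x ∈ I) : weightedSum n T ν x ∈ I := by
  rw [weightedSum_apply]
  refine sum_mem fun k _ ↦ ?_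
  rw [Algebra.smul_def, Module.End.pow_apply]
  exact I.mul_mem_left _ _ (Set.MapsTo.iterate (s := {y | y ∈ I}) hT k hx)

/-- Conjugation `x ↦ w x w⁻¹` by a unit, as a linear map. -/
def conjEnd (K : Type*) {A : Type*} [Field K] [Ring A] [Algebra K A] (w : Aˣ) : Module.End K A :=
  LinearMap.mulLeft K (w : A) * LinearMap.mulRight K ((w⁻¹ : Aˣ) : A)

theorem conjEnd_apply (w : Aˣ) (x : A) : conjEnd K w x = w * (x * (w⁻¹ : Aˣ)) := rfl

theorem conjEnd_mem (w : Aˣ) {I : TwoSidedIdeal A} {x : A} (hx : x ∈ I) : conjEnd K w x ∈ I :=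
  I.mul_mem_left _ _ (I.mul_mem_right _ _ hx)

theorem weightedSum_conjEnd_of_mem_center (n : ℕ) (w : Aˣ) {x : A}
    (hx : x ∈ Subalgebra.center K A) : weightedSum n (conjEnd K w) 1 x = (n : K) • x := by
  have h : conjEnd K w x = (1 : K) • x := by
    rw [conjEnd_apply, ← Subalgebra.mem_center_iff.1 hx, ← mul_assoc, Units.mul_inv, one_mul,
      one_smul]
  simp [weightedSum_apply, pow_apply_of_eigen h, Nat.cast_smul_eq_nsmul]

end Averaging

section Monomials

variable {K A : Type*} [Field K] [Ring A] [Algebra K A] {n : ℕ} {ε : K} {u v : Aˣ}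

theorem conjEnd_monomial (h : (u : A) * v = ε • ((v : A) * u)) (i j : ℕ) :
    conjEnd K u ((v : A) ^ j * (u : A) ^ i) = ε ^ j • ((v : A) ^ j * (u : A) ^ i) := by
  have h1 : SemiconjBy (u : A) v (ε • (v : A)) := by
    rw [SemiconjBy, h, smul_mul_assoc]
  have h2 := (h1.pow_right j).mul_right (Commute.pow_right (Commute.refl (u : A)) i)
  rw [conjEnd_apply, ← mul_assoc, h2.eq, mul_assoc, Units.mul_inv, mul_one, smul_pow,
    smul_mul_assoc]

theorem conjEnd_inv_monomial (h : (u : A) * v = ε • ((v : A) * u)) (i j : ℕ) :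
    conjEnd K v⁻¹ ((v : A) ^ j * (u : A) ^ i) = ε ^ i • ((v : A) ^ j * (u : A) ^ i) := by
  have h1 : SemiconjBy (v : A) (ε • (u : A)) u := by
    rw [SemiconjBy, h, mul_smul_comm]
  have h2 := SemiconjBy.mul_right (Commute.pow_right (Commute.refl (v : A)) j) (h1.pow_right i)
  rw [conjEnd_apply, inv_inv, ← h2.eq, Units.inv_mul_cancel_left, smul_pow, mul_smul_comm]

/-- The composite of weighted sums isolating the coefficient of `v ^ p.2 * u ^ p.1`. -/
def isolate (ε : K) (u v : Aˣ) (p : Fin n × Fin n) : Module.End K A :=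
  weightedSum n (conjEnd K v⁻¹) (ε ^ (p.1 : ℕ))⁻¹ * weightedSum n (conjEnd K u) (ε ^ (p.2 : ℕ))⁻¹

theorem isolate_monomial (hε : IsPrimitiveRoot ε n) (h : (u : A) * v = ε • ((v : A) * u))
    (p q : Fin n × Fin n) :
    isolate ε u v p ((v : A) ^ (q.2 : ℕ) * (u : A) ^ (q.1 : ℕ)) =
      (if q = p then (n : K) ^ 2 else 0) • ((v : A) ^ (q.2 : ℕ) * (u : A) ^ (q.1 : ℕ)) := by
  rw [isolate, Module.End.mul_apply, weightedSum_apply_primitiveRoot hε (conjEnd_monomial h _ _),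
    map_smul, weightedSum_apply_primitiveRoot hε (conjEnd_inv_monomial h _ _), smul_smul]
  congr 1
  by_cases h1 : q.1 = p.1 <;> by_cases h2 : q.2 = p.2 <;> simp [Prod.ext_iff, h1, h2, sq]

theorem isolate_sum (hε : IsPrimitiveRoot ε n) (h : (u : A) * v = ε • ((v : A) * u))
    (p : Fin n × Fin n) (c : Fin n × Fin n → K) :
    isolate ε u v p (∑ q, c q • ((v : A) ^ (q.2 : ℕ) * (u : A) ^ (q.1 : ℕ))) =
      (c p * (n : K) ^ 2) • ((v : A) ^ (p.2 : ℕ) * (u : A) ^ (p.1 : ℕ)) := by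
  simp only [map_sum, map_smul, isolate_monomial hε h, smul_smul]
  rw [Finset.sum_eq_single p] <;> simp +contextual

theorem natCast_ne_zero_of_primitiveRoot (hn : 0 < n) (hε : IsPrimitiveRoot ε n) :
    (n : K) ≠ 0 :=
  have : NeZero n := ⟨hn.ne'⟩
  (hε.neZero').out

theorem isUnit_monomial (i j : ℕ) : IsUnit ((v : A) ^ j * (u : A) ^ i) :=
  (v.isUnit.pow j).mul (u.isUnit.pow i)

theorem linearIndependent_monomial [Nontrivial A] (hn : 0 < n) (hε : IsPrimitiveRoot ε n)
    (h : (u : A) * v = ε • ((v : A) * u)) :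
    LinearIndependent K
      fun q : Fin n × Fin n ↦ (v : A) ^ (q.2 : ℕ) * (u : A) ^ (q.1 : ℕ) := by
  rw [Fintype.linearIndependent_iff]
  intro c hc p
  have h1 := isolate_sum hε h p c
  rw [hc, map_zero, eq_comm, smul_eq_zero] at h1
  have h2 := natCast_ne_zero_of_primitiveRoot hn hε
  simpa [(isUnit_monomial (u := u) (v := v) _ _).ne_zero, h2] using h1

theorem exists_eq_sum_monomial
    (hspan : Submodule.span K (Set.range
      fun q : Fin n × Fin n ↦ (v : A) ^ (q.2 : ℕ) * (u : A) ^ (q.1 : ℕ)) = ⊤)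
    (x : A) : ∃ c : Fin n × Fin n → K,
    ∑ q, c q • ((v : A) ^ (q.2 : ℕ) * (u : A) ^ (q.1 : ℕ)) = x :=
  (Submodule.mem_span_range_iff_exists_fun K).1 (hspan ▸ Submodule.mem_top)

theorem isCentral_of_span_monomial
    (hspan : Submodule.span K (Set.range
      fun q : Fin n × Fin n ↦ (v : A) ^ (q.2 : ℕ) * (u : A) ^ (q.1 : ℕ)) = ⊤)
    (hn : 0 < n) (hε : IsPrimitiveRoot ε n)
    (h : (u : A) * v = ε • ((v : A) * u)) : Algebra.IsCentral K A where
  out x hx := by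
    have h2 := natCast_ne_zero_of_primitiveRoot hn hε
    obtain ⟨c, rfl⟩ := exists_eq_sum_monomial hspan x
    have h1 := isolate_sum hε h (⟨0, hn⟩, ⟨0, hn⟩) c
    simp only [isolate, Module.End.mul_apply, pow_zero, inv_one,
      weightedSum_conjEnd_of_mem_center n _ hx, map_smul, smul_smul, mul_one] at h1
    rw [← sq, mul_comm, mul_smul] at h1
    rw [smul_right_injective A (pow_ne_zero 2 h2) h1, Algebra.mem_bot]
    exact ⟨_, Algebra.algebraMap_eq_smul_one _⟩

theorem isSimpleRing_of_span_monomial [Nontrivial A]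
    (hspan : Submodule.span K (Set.range
      fun q : Fin n × Fin n ↦ (v : A) ^ (q.2 : ℕ) * (u : A) ^ (q.1 : ℕ)) = ⊤)
    (hn : 0 < n) (hε : IsPrimitiveRoot ε n)
    (h : (u : A) * v = ε • ((v : A) * u)) : IsSimpleRing A where
  simple := {
    eq_bot_or_eq_top I := by
      have h2 := natCast_ne_zero_of_primitiveRoot hn hε
      by_cases hI : ∀ x ∈ I, x = 0
      · left
        exact le_bot_iff.1 fun x hx ↦ (TwoSidedIdeal.mem_bot A).2 (hI x hx)
      · right
        push Not at hI
        obtain ⟨x, hx, hx0⟩ := hI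
        obtain ⟨c, rfl⟩ := exists_eq_sum_monomial hspan x
        obtain ⟨p, -, hp⟩ := Finset.exists_ne_zero_of_sum_ne_zero hx0
        have hc : c p ≠ 0 := fun h0 ↦ hp (by rw [h0, zero_smul])
        have h1 : isolate ε u v p _ ∈ I :=
          weightedSum_mem n (fun _ ↦ conjEnd_mem _) _
            (weightedSum_mem n (fun _ ↦ conjEnd_mem _) _ hx)
        rw [isolate_sum hε h, Algebra.smul_def] at h1
        obtain ⟨w, hw⟩ := ((IsUnit.mk0 _ (mul_ne_zero hc (pow_ne_zero 2 h2))).map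
          (algebraMap K A)).mul (isUnit_monomial (u := u) (v := v) p.1 p.2)
        rw [← hw] at h1
        rw [← TwoSidedIdeal.one_mem_iff, ← w.inv_mul]
        exact I.mul_mem_left _ _ h1 }

theorem finrank_of_span_monomial [Nontrivial A]
    (hspan : Submodule.span K (Set.range
      fun q : Fin n × Fin n ↦ (v : A) ^ (q.2 : ℕ) * (u : A) ^ (q.1 : ℕ)) = ⊤)
    (hn : 0 < n) (hε : IsPrimitiveRoot ε n)
    (h : (u : A) * v = ε • ((v : A) * u)) : Module.finrank K A = n ^ 2 := by
  rw [Module.finrank_eq_card_basis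
    (Module.Basis.mk (linearIndependent_monomial hn hε h) hspan.ge)]
  simp [sq]

end Monomials

section Spanning

variable {K A : Type*} [Field K] [Ring A] [Algebra K A] {n : ℕ}

theorem isUnit_of_pow_eq_algebraMap (hn : 0 < n) {x : A} {c : K} (hc : c ≠ 0)
    (h : x ^ n = algebraMap K A c) : IsUnit x :=
  (isUnit_pow_iff hn.ne').1 (h ▸ (IsUnit.mk0 c hc).map (algebraMap K A))

theorem pow_eq_smul_pow_mod {x : A} {c : K} (h : x ^ n = algebraMap K A c) (k : ℕ) :
    x ^ k = c ^ (k / n) • x ^ (k % n) := by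
  conv_lhs => rw [← Nat.div_add_mod k n, pow_add, pow_mul, h, ← map_pow, ← Algebra.smul_def]

theorem span_monomial_eq_top (hn : 0 < n) {ε a b : K} {u v : A} (hu : u ^ n = algebraMap K A a)
    (hv : v ^ n = algebraMap K A b) (h : u * v = ε • (v * u)) {f : FreeAlgebra K (Fin 2) →ₐ[K] A}
    (hfu : f (FreeAlgebra.ι K 0) = u) (hfv : f (FreeAlgebra.ι K 1) = v)
    (hf : Function.Surjective f) : Submodule.span K (Set.range
    fun q : Fin n × Fin n ↦ v ^ (q.2 : ℕ) * u ^ (q.1 : ℕ)) = ⊤ := by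
  set S := Submodule.span K (Set.range
    fun q : Fin n × Fin n ↦ v ^ (q.2 : ℕ) * u ^ (q.1 : ℕ)) with hS
  have hmem (i j : ℕ) : v ^ j * u ^ i ∈ S := by
    rw [pow_eq_smul_pow_mod hu i, pow_eq_smul_pow_mod hv j, smul_mul_smul_comm]
    exact S.smul_mem _
      (Submodule.subset_span ⟨(⟨i % n, Nat.mod_lt _ hn⟩, ⟨j % n, Nat.mod_lt _ hn⟩), rfl⟩)
  have hgen (w : A) (hw : ∀ i j : ℕ, w * (v ^ j * u ^ i) ∈ S) : ∀ y ∈ S, w * y ∈ S := by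
    suffices S ≤ S.comap (LinearMap.mulLeft K w) from this
    rw [hS, Submodule.span_le, ← hS]
    rintro _ ⟨q, rfl⟩
    exact hw _ _
  have hmul (x : FreeAlgebra K (Fin 2)) : ∀ y ∈ S, f x * y ∈ S := by
    induction x using FreeAlgebra.induction with
    | grade0 r =>
      intro y hy
      rw [AlgHom.commutes, ← Algebra.smul_def]
      exact S.smul_mem _ hy
    | grade1 x =>
      fin_cases x
      · refine hgen _ fun i j ↦ ?_
        change f (FreeAlgebra.ι K 0) * _ ∈ S
        rw [hfu]
        have h1 : SemiconjBy u v (ε • v) := by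
          rw [SemiconjBy, h, smul_mul_assoc]
        rw [← mul_assoc, (h1.pow_right j).eq, mul_assoc, ← pow_succ', smul_pow, smul_mul_assoc]
        exact S.smul_mem _ (hmem _ _)
      · refine hgen _ fun i j ↦ ?_
        change f (FreeAlgebra.ι K 1) * _ ∈ S
        rw [hfv, ← mul_assoc, ← pow_succ']
        exact hmem _ _
    | mul x y hx hy =>
      intro z hz
      rw [map_mul, mul_assoc]
      exact hx _ (hy _ hz)
    | add x y hx hy =>
      intro z hz
      rw [map_add, add_mul]
      exact S.add_mem (hx _ hz) (hy _ hz)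
  rw [eq_top_iff]
  rintro x -
  obtain ⟨x, rfl⟩ := hf x
  simpa using hmul x 1 (by simpa using hmem 0 0)

end Spanning

section Presentation

variable (K : Type) [Field K] (n : ℕ) (ε a b : K)

/-- The quotient map from the free algebra. -/
noncomputable def mk : FreeAlgebra K (Fin 2) →ₐ[K] SymbolAlgebra K n ε a b :=
  RingQuot.mkAlgHom K (SymbolRel K n ε a b)

theorem mk_surjective : Function.Surjective (mk K n ε a b) :=
  RingQuot.mkAlgHom_surjective K _

theorem mk_rel {x y : FreeAlgebra K (Fin 2)} (h : SymbolRel K n ε a b x y) :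
    mk K n ε a b x = mk K n ε a b y :=
  RingQuot.mkAlgHom_rel K h

/-- The first generator. -/
noncomputable def u : SymbolAlgebra K n ε a b := mk K n ε a b (FreeAlgebra.ι K 0)

/-- The second generator. -/
noncomputable def v : SymbolAlgebra K n ε a b := mk K n ε a b (FreeAlgebra.ι K 1)

theorem u_pow : u K n ε a b ^ n = algebraMap K _ a := by
  rw [u, ← map_pow, mk_rel K n ε a b (Or.inl ⟨rfl, rfl⟩), AlgHom.commutes]

theorem v_pow : v K n ε a b ^ n = algebraMap K _ b := by
  rw [v, ← map_pow, mk_rel K n ε a b (Or.inr (Or.inl ⟨rfl, rfl⟩)), AlgHom.commutes]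

theorem u_mul_v : u K n ε a b * v K n ε a b = ε • (v K n ε a b * u K n ε a b) := by
  rw [u, v, ← map_mul, mk_rel K n ε a b (Or.inr (Or.inr ⟨rfl, rfl⟩)), map_mul, AlgHom.commutes,
    map_mul, Algebra.smul_def]

variable {K n ε a b} in
/-- The symbol algebra is nontrivial as soon as its relations hold in a nontrivial algebra. -/
theorem nontrivial_of_relations {B : Type*} [Ring B] [Algebra K B] [Nontrivial B] {x y : B}
    (hx : x ^ n = algebraMap K B a) (hy : y ^ n = algebraMap K B b)
    (hxy : x * y = ε • (y * x)) : Nontrivial (SymbolAlgebra K n ε a b) := by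
  let f : RingQuot (SymbolRel K n ε a b) →ₐ[K] B :=
    RingQuot.liftAlgHom K ⟨FreeAlgebra.lift K ![x, y], by
      rintro p q (⟨rfl, rfl⟩ | ⟨rfl, rfl⟩ | ⟨rfl, rfl⟩)
      · simp [hx]
      · simp [hy]
      · simp [hxy, Algebra.smul_def]⟩
  have : Nontrivial (RingQuot (SymbolRel K n ε a b)) := f.toRingHom.domain_nontrivial
  exact this

variable {K n ε} in
/-- The relations hold for a scaled clock operator and a scaled shift operator on
`ZMod n → AlgebraicClosure K`. -/
theorem nontrivial (hn : 0 < n) (hε : ε ^ n = 1) : Nontrivial (SymbolAlgebra K n ε a b) := by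
  have : NeZero n := ⟨hn.ne'⟩
  obtain ⟨α, hα⟩ := IsAlgClosed.exists_pow_nat_eq (algebraMap K (AlgebraicClosure K) a) hn
  obtain ⟨β, hβ⟩ := IsAlgClosed.exists_pow_nat_eq (algebraMap K (AlgebraicClosure K) b) hn
  let χ : AddChar (ZMod n) K := AddChar.zmodChar n hε
  let X : Module.End K (ZMod n → AlgebraicClosure K) :=
    { toFun f i := α * χ i • f i
      map_add' f g := by ext i; simp [mul_add]
      map_smul' c f := by ext i; simp [smul_comm c] }
  let Y : Module.End K (ZMod n → AlgebraicClosure K) :=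
    { toFun f i := β * f (i - 1)
      map_add' f g := by ext i; simp [mul_add]
      map_smul' c f := by ext i; simp }
  have hX (k : ℕ) (f : ZMod n → AlgebraicClosure K) (i : ZMod n) :
      (X ^ k) f i = α ^ k * χ i ^ k • f i := by
    induction k with
    | zero => simp
    | succ k ih =>
      rw [pow_succ', Module.End.mul_apply]
      change α * χ i • (X ^ k) f i = _
      rw [ih]
      simp only [Algebra.smul_def, map_pow]
      ring
  have hY (k : ℕ) (f : ZMod n → AlgebraicClosure K) (i : ZMod n) :
      (Y ^ k) f i = β ^ k * f (i - k) := by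
    induction k generalizing i with
    | zero => simp
    | succ k ih =>
      rw [pow_succ', Module.End.mul_apply]
      change β * (Y ^ k) f (i - 1) = _
      rw [ih, sub_sub, add_comm 1, Nat.cast_succ]
      ring
  refine nontrivial_of_relations (x := X) (y := Y) ?_ ?_ ?_
  · refine LinearMap.ext fun f ↦ funext fun i ↦ ?_
    rw [hX, hα, ← AddChar.map_nsmul_eq_pow]
    simp [Algebra.smul_def]
  · refine LinearMap.ext fun f ↦ funext fun i ↦ ?_
    rw [hY, hβ]
    simp [Algebra.smul_def]
  · refine LinearMap.ext fun f ↦ funext fun i ↦ ?_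
    change α * χ i • (β * f (i - 1)) = ε • (β * (α * χ (i - 1) • f (i - 1)))
    have h : χ i = ε * χ (i - 1) := by
      have h1 : χ 1 = ε := by
        simpa using AddChar.zmodChar_apply' hε 1
      rw [← h1, ← AddChar.map_add_eq_mul, add_sub_cancel]
    rw [h]
    simp only [Algebra.smul_def, map_mul]
    ring

end Presentation

end SymbolAlgebra

/-- for a field `K` with a primitive `n`-th root of unity `ε` and `a, b ∈ K*`,
the symbol algebra `(a,b;K,ε)` is a central simple `K`-algebra of dimension `n²`. -/
theorem stmt5 (K : Type) [Field K] (n : ℕ) (hn : 0 < n) (ε : K)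
    (hε : IsPrimitiveRoot ε n) (a b : K) (ha : a ≠ 0) (hb : b ≠ 0) :
    Algebra.IsCentral K (SymbolAlgebra K n ε a b) ∧
      IsSimpleRing (SymbolAlgebra K n ε a b) ∧
      Module.finrank K (SymbolAlgebra K n ε a b) = n ^ 2 := by
  have := SymbolAlgebra.nontrivial a b hn hε.pow_eq_one
  obtain ⟨u, hu⟩ := SymbolAlgebra.isUnit_of_pow_eq_algebraMap hn ha
    (SymbolAlgebra.u_pow K n ε a b)
  obtain ⟨v, hv⟩ := SymbolAlgebra.isUnit_of_pow_eq_algebraMap hn hb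
    (SymbolAlgebra.v_pow K n ε a b)
  have h := SymbolAlgebra.u_mul_v K n ε a b
  have hspan := SymbolAlgebra.span_monomial_eq_top hn (SymbolAlgebra.u_pow K n ε a b)
    (SymbolAlgebra.v_pow K n ε a b) h rfl rfl (SymbolAlgebra.mk_surjective K n ε a b)
  rw [← hu, ← hv] at h hspan
  exact ⟨SymbolAlgebra.isCentral_of_span_monomial hspan hn hε h,
    SymbolAlgebra.isSimpleRing_of_span_monomial hspan hn hε h,
    SymbolAlgebra.finrank_of_span_monomial hspan hn hε h⟩
end
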